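/- arXiv:2312.11204 — 7 statements merged into one kernel-verified Lean document; each statement's English description precedes it below -/
import Mathlib

section
/- Assume g is odd. Then for every θ ∈ K, each of A_θ, B_θ, C_θ, D_θ is nonzero; moreover A_∞, B_∞, C_∞, D_∞ are nonzero. -/
open NumberField

/-- `D_θ = a^{2h+1} b^{2h+1} θ^{g+1} − 1`. -/
def Dval {F : Type*} [Field F] (a b : F) (h g : ℕ) (θ : F) : F :=
  a ^ (2 * h + 1) * b ^ (2 * h + 1) * θ ^ (g + 1) - 1

/-- `C_θ = a^{2h+1} θ^{g+1} − 1`. -/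
def Cval {F : Type*} [Field F] (a : F) (h g : ℕ) (θ : F) : F :=
  a ^ (2 * h + 1) * θ ^ (g + 1) - 1

/-- `A_θ = a^{4h+3} θ^{2g+2} + b c² d D_θ²`. -/
def Aval {F : Type*} [Field F] (a b c d : F) (h g : ℕ) (θ : F) : F :=
  a ^ (4 * h + 3) * θ ^ (2 * g + 2) + b * c ^ 2 * d * (Dval a b h g θ) ^ 2

/-- `B_θ = a^{4h+3} θ^{2g+2} + (b c² d + 2c) D_θ²`. -/
def Bval {F : Type*} [Field F] (a b c d : F) (h g : ℕ) (θ : F) : F :=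
  a ^ (4 * h + 3) * θ ^ (2 * g + 2) + (b * c ^ 2 * d + 2 * c) * (Dval a b h g θ) ^ 2

/-- `D_∞ = a^{2h+1} b^{2h+1}`. -/
def Dinf {F : Type*} [Field F] (a b : F) (h : ℕ) : F := a ^ (2 * h + 1) * b ^ (2 * h + 1)

/-- `C_∞ = a^{2h+1}`. -/
def Cinf {F : Type*} [Field F] (a : F) (h : ℕ) : F := a ^ (2 * h + 1)

/-- `A_∞ = a^{4h+3} + b c² d D_∞²`. -/
def Ainf {F : Type*} [Field F] (a b c d : F) (h : ℕ) : F :=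
  a ^ (4 * h + 3) + b * c ^ 2 * d * (Dinf a b h) ^ 2

/-- `B_∞ = a^{4h+3} + (b c² d + 2c) D_∞²`. -/
def Binf {F : Type*} [Field F] (a b c d : F) (h : ℕ) : F :=
  a ^ (4 * h + 3) + (b * c ^ 2 * d + 2 * c) * (Dinf a b h) ^ 2

/-- `a, b, c, d ∈ 𝓞 K` generate pairwise distinct nonzero prime ideals,
none of which divides `(2)`. -/
def GoodParams (K : Type*) [Field K] [NumberField K] (a b c d : 𝓞 K) : Prop :=
  (Ideal.span {a} : Ideal (𝓞 K)).IsPrime ∧ (Ideal.span {b} : Ideal (𝓞 K)).IsPrime ∧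
  (Ideal.span {c} : Ideal (𝓞 K)).IsPrime ∧ (Ideal.span {d} : Ideal (𝓞 K)).IsPrime ∧
  a ≠ 0 ∧ b ≠ 0 ∧ c ≠ 0 ∧ d ≠ 0 ∧
  (Ideal.span {a} : Ideal (𝓞 K)) ≠ Ideal.span {b} ∧
  (Ideal.span {a} : Ideal (𝓞 K)) ≠ Ideal.span {c} ∧
  (Ideal.span {a} : Ideal (𝓞 K)) ≠ Ideal.span {d} ∧
  (Ideal.span {b} : Ideal (𝓞 K)) ≠ Ideal.span {c} ∧
  (Ideal.span {b} : Ideal (𝓞 K)) ≠ Ideal.span {d} ∧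
  (Ideal.span {c} : Ideal (𝓞 K)) ≠ Ideal.span {d} ∧
  ¬ a ∣ 2 ∧ ¬ b ∣ 2 ∧ ¬ c ∣ 2 ∧ ¬ d ∣ 2

/-- In a domain with well-founded divisibility, `p * w * x²` and `u * y²` have `p`-adic valuations
of different parity when the prime `p` divides neither `w` nor `u`. -/
theorem Prime.eq_zero_of_mul_sq_eq_mul_sq {R : Type*} [CommRing R] [IsDomain R] [WfDvdMonoid R]
    {p w u x y : R} (hp : Prime p) (hw : ¬ p ∣ w) (hu : ¬ p ∣ u)
    (hxy : p * w * x ^ 2 = u * y ^ 2) : x = 0 ∧ y = 0 := by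
  have hw0 : w ≠ 0 := fun h0 => hw (h0 ▸ dvd_zero p)
  have hu0 : u ≠ 0 := fun h0 => hu (h0 ▸ dvd_zero p)
  have hiff : x = 0 ↔ y = 0 := by
    constructor <;> rintro rfl <;> simpa [hp.ne_zero, hw0, hu0] using hxy
  by_cases hx : x = 0
  · exact ⟨hx, hiff.1 hx⟩
  · have hy : y ≠ 0 := fun hy => hx (hiff.2 hy)
    exfalso
    have hfx := FiniteMultiplicity.of_prime_left hp hx
    have hfy := FiniteMultiplicity.of_prime_left hp hy
    have hfp := FiniteMultiplicity.of_prime_left hp hp.ne_zero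
    have key := congrArg (emultiplicity p) hxy
    rw [emultiplicity_mul hp, emultiplicity_mul hp, emultiplicity_mul hp, emultiplicity_pow hp,
      emultiplicity_pow hp, emultiplicity_eq_zero.2 hw, emultiplicity_eq_zero.2 hu,
      hfx.emultiplicity_eq_multiplicity, hfy.emultiplicity_eq_multiplicity,
      hfp.emultiplicity_eq_multiplicity, multiplicity_self] at key
    norm_cast at key
    omega

/-- The fraction field version of `Prime.eq_zero_of_mul_sq_eq_mul_sq`. -/
theorem Prime.eq_zero_of_algebraMap_mul_sq_eq {R F : Type*} [CommRing R] [IsDomain R]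
    [WfDvdMonoid R] [Field F] [Algebra R F] [IsFractionRing R F] {p w u : R} {x y : F}
    (hp : Prime p) (hw : ¬ p ∣ w) (hu : ¬ p ∣ u)
    (hxy : algebraMap R F p * algebraMap R F w * x ^ 2 = algebraMap R F u * y ^ 2) :
    x = 0 ∧ y = 0 := by
  obtain ⟨m, s, hs, rfl⟩ := IsFractionRing.div_surjective (A := R) x
  obtain ⟨n, t, ht, rfl⟩ := IsFractionRing.div_surjective (A := R) y
  have hs0 : s ≠ 0 := nonZeroDivisors.ne_zero hs
  have ht0 : t ≠ 0 := nonZeroDivisors.ne_zero ht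
  have hs1 : algebraMap R F s ≠ 0 := by simpa using hs0
  have ht1 : algebraMap R F t ≠ 0 := by simpa using ht0
  have h1 : p * w * (m * t) ^ 2 = u * (n * s) ^ 2 := by
    apply IsFractionRing.injective R F
    simp only [map_mul, map_pow]
    field_simp at hxy
    linear_combination hxy
  have h2 := hp.eq_zero_of_mul_sq_eq_mul_sq hw hu h1
  simpa [hs0, ht0] using h2

/-- A prime element does not divide another one generating a different ideal. -/
theorem Prime.not_dvd_of_span_singleton_ne {R : Type*} [CommRing R] [IsDomain R] {p q : R}
    (hp : Prime p) (hq : Prime q) (hne : (Ideal.span {p} : Ideal R) ≠ Ideal.span {q}) :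
    ¬ p ∣ q := fun hd =>
  hne (Ideal.span_singleton_eq_span_singleton.2 (hp.associated_of_dvd hq hd))

/-- Lemma 4.1(1): if `g` is odd then `A_θ, B_θ, C_θ, D_θ` are nonzero for all `θ ∈ K`,
and `A_∞, B_∞, C_∞, D_∞` are nonzero. -/
theorem stmt1 (K : Type*) [Field K] [NumberField K] (h g : ℕ) (hg1 : 1 ≤ g) (hgodd : Odd g)
    (a b c d : 𝓞 K) (hP : GoodParams K a b c d) :
    (∀ θ : K,
      Aval (algebraMap (𝓞 K) K a) (algebraMap (𝓞 K) K b) (algebraMap (𝓞 K) K c)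
          (algebraMap (𝓞 K) K d) h g θ ≠ 0 ∧
      Bval (algebraMap (𝓞 K) K a) (algebraMap (𝓞 K) K b) (algebraMap (𝓞 K) K c)
          (algebraMap (𝓞 K) K d) h g θ ≠ 0 ∧
      Cval (algebraMap (𝓞 K) K a) h g θ ≠ 0 ∧
      Dval (algebraMap (𝓞 K) K a) (algebraMap (𝓞 K) K b) h g θ ≠ 0) ∧
    (Ainf (algebraMap (𝓞 K) K a) (algebraMap (𝓞 K) K b) (algebraMap (𝓞 K) K c)
        (algebraMap (𝓞 K) K d) h ≠ 0 ∧
      Binf (algebraMap (𝓞 K) K a) (algebraMap (𝓞 K) K b) (algebraMap (𝓞 K) K c)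
        (algebraMap (𝓞 K) K d) h ≠ 0 ∧
      Cinf (algebraMap (𝓞 K) K a) h ≠ 0 ∧
      Dinf (algebraMap (𝓞 K) K a) (algebraMap (𝓞 K) K b) h ≠ 0) := by
  obtain ⟨ha, hb, hc, hd, ha0, hb0, hc0, hd0, hab, hac, had, hbc, hbd, hcd, ha2, hb2, hc2, hd2⟩ :=
    hP
  rw [Ideal.span_singleton_prime ‹_›] at ha hb hc hd
  have nab : ¬ a ∣ b := ha.not_dvd_of_span_singleton_ne hb hab
  have nac : ¬ a ∣ c := ha.not_dvd_of_span_singleton_ne hc hac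
  have nad : ¬ a ∣ d := ha.not_dvd_of_span_singleton_ne hd had
  have nca : ¬ c ∣ -a := by
    rw [dvd_neg]
    exact hc.not_dvd_of_span_singleton_ne ha hac.symm
  have na1 : ¬ a ∣ 1 := ha.not_dvd_one
  have nau : ¬ a ∣ -(b * c ^ 2 * d) := by
    rw [dvd_neg, ha.dvd_mul, ha.dvd_mul, ha.dvd_pow_iff_dvd two_ne_zero]
    tauto
  have ncw : ¬ c ∣ b * c * d + 2 := by
    rwa [dvd_add_right ⟨b * d, by ring⟩]
  have nabh : ¬ a ∣ b ^ (2 * h + 1) := fun hdvd => nab (ha.dvd_of_dvd_pow hdvd)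
  have hA : algebraMap (𝓞 K) K a ≠ 0 := by simpa using ha0
  have hB : algebraMap (𝓞 K) K b ≠ 0 := by simpa using hb0
  have hDinf : Dinf (algebraMap (𝓞 K) K a) (algebraMap (𝓞 K) K b) h ≠ 0 :=
    mul_ne_zero (pow_ne_zero _ hA) (pow_ne_zero _ hB)
  obtain ⟨k, rfl⟩ := hgodd
  refine ⟨fun θ => ?_, ?_, ?_, pow_ne_zero _ hA, hDinf⟩
  · have hD : Dval (algebraMap (𝓞 K) K a) (algebraMap (𝓞 K) K b) h (2 * k + 1) θ ≠ 0 := by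
      intro h0
      refine one_ne_zero (ha.eq_zero_of_algebraMap_mul_sq_eq (F := K) nabh na1
        (x := algebraMap (𝓞 K) K a ^ h * θ ^ (k + 1)) (y := 1) ?_).2
      simp only [map_pow, map_one]
      unfold Dval at h0
      linear_combination h0
    refine ⟨fun h0 => hD ?_, fun h0 => hD ?_, fun h0 => ?_, hD⟩
    · refine (ha.eq_zero_of_algebraMap_mul_sq_eq (F := K) na1 nau
        (x := algebraMap (𝓞 K) K a ^ (2 * h + 1) * θ ^ (2 * k + 2)) ?_).2
      simp only [map_pow, map_one, map_mul, map_neg]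
      unfold Aval at h0
      linear_combination h0
    · refine (hc.eq_zero_of_algebraMap_mul_sq_eq (F := K) ncw nca
        (y := algebraMap (𝓞 K) K a ^ (2 * h + 1) * θ ^ (2 * k + 2)) ?_).1
      simp only [map_mul, map_neg, map_add, map_ofNat]
      unfold Bval at h0
      linear_combination h0
    · refine one_ne_zero (ha.eq_zero_of_algebraMap_mul_sq_eq (F := K) na1 na1
        (x := algebraMap (𝓞 K) K a ^ h * θ ^ (k + 1)) (y := 1) ?_).2
      simp only [map_one]
      unfold Cval at h0
      linear_combination h0
  · intro h0
    refine hDinf (ha.eq_zero_of_algebraMap_mul_sq_eq (F := K) na1 nau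
      (x := algebraMap (𝓞 K) K a ^ (2 * h + 1)) ?_).2
    simp only [map_pow, map_one, map_mul, map_neg]
    unfold Ainf at h0
    linear_combination h0
  · intro h0
    refine hDinf (hc.eq_zero_of_algebraMap_mul_sq_eq (F := K) ncw nca
      (y := algebraMap (𝓞 K) K a ^ (2 * h + 1)) ?_).1
    simp only [map_mul, map_neg, map_add, map_ofNat]
    unfold Binf at h0
    linear_combination h0
end

section
/- Let K̄ be an algebraic closure of K. For every θ ∈ K̄: (1) if A_θ = B_θ then D_θ = 0 and A_θ = B_θ ≠ 0; (2) if C_θ = 0 then A_θ ≠ 0, B_θ ≠ 0 and D_θ ≠ 0. -/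
open NumberField

/-- A generator of a nonzero prime ideal is not divisible by a generator of a different prime
ideal. -/
theorem not_dvd_of_span_singleton_isPrime {R : Type*} [CommRing R] [IsDomain R] {x y : R}
    (hx : (Ideal.span {x}).IsPrime) (hx0 : x ≠ 0) (hy : (Ideal.span {y}).IsPrime)
    (hxy : Ideal.span {x} ≠ Ideal.span {y}) : ¬ y ∣ x := by
  intro hdvd
  have hyu : ¬ IsUnit y := fun hu => hy.ne_top (Ideal.span_singleton_eq_top.2 hu)
  have hirr : Irreducible x := ((Ideal.span_singleton_prime hx0).1 hx).irreducible
  exact hxy (Ideal.span_singleton_eq_span_singleton.2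
    ((hirr.dvd_iff.1 hdvd).resolve_left hyu))

/-- If `C_θ = 0` then `D_θ = b^{2h+1} - 1`. -/
theorem Dval_eq_of_Cval_eq_zero {F : Type*} [Field F] {a b : F} {h g : ℕ} {θ : F}
    (hC : Cval a h g θ = 0) : Dval a b h g θ = b ^ (2 * h + 1) - 1 := by
  unfold Cval at hC
  unfold Dval
  linear_combination b ^ (2 * h + 1) * hC

/-- If `C_θ = 0` then `a^{4h+3} θ^{2g+2} = a`. -/
theorem leading_term_eq_of_Cval_eq_zero {F : Type*} [Field F] {a : F} {h g : ℕ} {θ : F}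
    (hC : Cval a h g θ = 0) : a ^ (4 * h + 3) * θ ^ (2 * g + 2) = a := by
  have h1 : a ^ (2 * h + 1) * θ ^ (g + 1) = 1 := sub_eq_zero.1 hC
  calc a ^ (4 * h + 3) * θ ^ (2 * g + 2) = a * (a ^ (2 * h + 1) * θ ^ (g + 1)) ^ 2 := by ring
    _ = a := by rw [h1]; ring

/-- Lemma 4.1(2)(3): over an algebraic closure `K̄` of `K`, for every `θ ∈ K̄`:
if `A_θ = B_θ` then `D_θ = 0` and `A_θ = B_θ ≠ 0`; and if `C_θ = 0`
then `A_θ ≠ 0`, `B_θ ≠ 0` and `D_θ ≠ 0`. -/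
theorem stmt2 (K : Type*) [Field K] [NumberField K] (h g : ℕ) (hg1 : 1 ≤ g)
    (a b c d : 𝓞 K) (hP : GoodParams K a b c d) :
    ∀ θ : AlgebraicClosure K,
      (Aval (algebraMap K (AlgebraicClosure K) (algebraMap (𝓞 K) K a))
            (algebraMap K (AlgebraicClosure K) (algebraMap (𝓞 K) K b))
            (algebraMap K (AlgebraicClosure K) (algebraMap (𝓞 K) K c))
            (algebraMap K (AlgebraicClosure K) (algebraMap (𝓞 K) K d)) h g θ =
        Bval (algebraMap K (AlgebraicClosure K) (algebraMap (𝓞 K) K a))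
            (algebraMap K (AlgebraicClosure K) (algebraMap (𝓞 K) K b))
            (algebraMap K (AlgebraicClosure K) (algebraMap (𝓞 K) K c))
            (algebraMap K (AlgebraicClosure K) (algebraMap (𝓞 K) K d)) h g θ →
        Dval (algebraMap K (AlgebraicClosure K) (algebraMap (𝓞 K) K a))
            (algebraMap K (AlgebraicClosure K) (algebraMap (𝓞 K) K b)) h g θ = 0 ∧
        Aval (algebraMap K (AlgebraicClosure K) (algebraMap (𝓞 K) K a))
            (algebraMap K (AlgebraicClosure K) (algebraMap (𝓞 K) K b))
            (algebraMap K (AlgebraicClosure K) (algebraMap (𝓞 K) K c))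
            (algebraMap K (AlgebraicClosure K) (algebraMap (𝓞 K) K d)) h g θ ≠ 0) ∧
      (Cval (algebraMap K (AlgebraicClosure K) (algebraMap (𝓞 K) K a)) h g θ = 0 →
        Aval (algebraMap K (AlgebraicClosure K) (algebraMap (𝓞 K) K a))
            (algebraMap K (AlgebraicClosure K) (algebraMap (𝓞 K) K b))
            (algebraMap K (AlgebraicClosure K) (algebraMap (𝓞 K) K c))
            (algebraMap K (AlgebraicClosure K) (algebraMap (𝓞 K) K d)) h g θ ≠ 0 ∧
        Bval (algebraMap K (AlgebraicClosure K) (algebraMap (𝓞 K) K a))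
            (algebraMap K (AlgebraicClosure K) (algebraMap (𝓞 K) K b))
            (algebraMap K (AlgebraicClosure K) (algebraMap (𝓞 K) K c))
            (algebraMap K (AlgebraicClosure K) (algebraMap (𝓞 K) K d)) h g θ ≠ 0 ∧
        Dval (algebraMap K (AlgebraicClosure K) (algebraMap (𝓞 K) K a))
            (algebraMap K (AlgebraicClosure K) (algebraMap (𝓞 K) K b)) h g θ ≠ 0) := by
  have hinj := FaithfulSMul.algebraMap_injective (𝓞 K) (AlgebraicClosure K)
  obtain ⟨ha, hb, hc, -, ha0, -, hc0, -, hab, hac, -⟩ := hP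
  have hba := not_dvd_of_span_singleton_isPrime ha ha0 hb hab
  have hca := not_dvd_of_span_singleton_isPrime ha ha0 hc hac
  rw [IsScalarTower.algebraMap_eq (𝓞 K) K (AlgebraicClosure K)] at hinj
  simp only [← RingHom.comp_apply]
  generalize (algebraMap K (AlgebraicClosure K)).comp (algebraMap (𝓞 K) K) = f at hinj ⊢
  have h2 : (2 : AlgebraicClosure K) ≠ 0 := two_ne_zero
  have hfa : f a ≠ 0 := (map_ne_zero_iff f hinj).2 ha0
  have hfc : f c ≠ 0 := (map_ne_zero_iff f hinj).2 hc0
  intro θ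
  refine ⟨fun hAB => ?_, fun hC => ?_⟩
  · have hD : Dval (f a) (f b) h g θ = 0 := by
      unfold Aval Bval at hAB
      have hmul : 2 * f c * Dval (f a) (f b) h g θ ^ 2 = 0 := by linear_combination -hAB
      simpa [h2, hfc] using hmul
    refine ⟨hD, ?_⟩
    have hθ : θ ≠ 0 := by
      rintro rfl
      simp [Dval] at hD
    simp [Aval, hD, hfa, hθ]
  · have hD := Dval_eq_of_Cval_eq_zero (b := f b) hC
    have hL := leading_term_eq_of_Cval_eq_zero hC
    refine ⟨fun hA => hba ?_, fun hB => hca ?_, fun hD0 => ?_⟩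
    · rw [Aval, hD, hL] at hA
      refine ⟨-(c ^ 2 * d * (b ^ (2 * h + 1) - 1) ^ 2), hinj ?_⟩
      simp only [map_mul, map_neg, map_sub, map_pow, map_one]
      linear_combination hA
    · rw [Bval, hD, hL] at hB
      refine ⟨-((b * c * d + 2) * (b ^ (2 * h + 1) - 1) ^ 2), hinj ?_⟩
      simp only [map_mul, map_neg, map_sub, map_add, map_pow, map_one, map_ofNat]
      linear_combination hB
    · rw [hD] at hD0
      have hpow : b ^ (2 * h + 1) = 1 := hinj (by
        rw [map_pow, map_one]
        exact sub_eq_zero.1 hD0)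
      exact hb.ne_top (Ideal.span_singleton_eq_top.2 (IsUnit.of_pow_eq_one hpow (by omega)))
end

section
/- Let F be a field of characteristic ≠ 2 and a, b, A, B, C ∈ F with a, b, A, B, C and A − B all nonzero. Then for every nonzero tuple (y, z, u, v) ∈ F⁴ satisfying a z² = b (u − A v)(u − B v) and y² = C² u v, the 2×4 Jacobian matrix of the two polynomials a z² − b (u − A v)(u − B v) and y² − C² u v with respect to the variables (y, z, u, v), namely the matrix with rows (0, 2 a z, −b(2u − (A+B)v), −b(2ABv − (A+B)u)) and (2y, 0, −C² v, −C² u), has rank 2. -/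
/-- A matrix with two rows has rank `2` when no nontrivial combination of its rows vanishes. -/
theorem Matrix.rank_eq_two_of_rows {F : Type*} [Field F] {n : ℕ} (M : Matrix (Fin 2) (Fin n) F)
    (h : ∀ p q : F, (∀ j, p * M 0 j + q * M 1 j = 0) → p = 0 ∧ q = 0) : M.rank = 2 := by
  have hM : LinearIndependent F M.row := by
    rw [Fintype.linearIndependent_iff]
    intro g hg
    have hpq := h (g 0) (g 1) fun j => by simpa [Fin.sum_univ_two] using congrFun hg j
    exact Fin.forall_fin_two.2 hpq
  simpa using hM.rank_matrix

/-- Smoothness of the genus-1 curve `a z² = b(u − Av)(u − Bv)`, `y² = C² u v` in ℙ³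
(Lemma 4.2(2)): at every nonzero solution the Jacobian matrix has rank 2. -/
theorem stmt4 (F : Type*) [Field F] (hchar : ringChar F ≠ 2)
    (a b A B C : F) (ha : a ≠ 0) (hb : b ≠ 0) (hA : A ≠ 0) (hB : B ≠ 0) (hC : C ≠ 0)
    (hAB : A - B ≠ 0) :
    ∀ y z u v : F, ¬ (y = 0 ∧ z = 0 ∧ u = 0 ∧ v = 0) →
      a * z ^ 2 = b * ((u - A * v) * (u - B * v)) →
      y ^ 2 = C ^ 2 * (u * v) →
      Matrix.rank
        (!![0, 2 * a * z, -(b * (2 * u - (A + B) * v)), -(b * (2 * A * B * v - (A + B) * u));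
            2 * y, 0, -(C ^ 2 * v), -(C ^ 2 * u)] : Matrix (Fin 2) (Fin 4) F) = 2 := by
  intro y z u v hne h₁ h₂
  have two_ne : (2 : F) ≠ 0 := Ring.two_ne_zero hchar
  refine Matrix.rank_eq_two_of_rows _ fun p q hpq => ?_
  have e₀ : q = 0 ∨ y = 0 := by simpa [two_ne] using hpq 0
  have e₁ : p = 0 ∨ z = 0 := by simpa [two_ne, ha] using hpq 1
  have e₂ : p * -(b * (2 * u - (A + B) * v)) + q * -(C ^ 2 * v) = 0 := hpq 2
  have e₃ : p * -(b * (2 * A * B * v - (A + B) * u)) + q * -(C ^ 2 * u) = 0 := hpq 3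
  by_cases hp : p = 0
  · refine ⟨hp, ?_⟩
    by_contra hq
    have hy : y = 0 := by simpa [hq] using e₀
    have hv : v = 0 := by simpa [hp, hq, hC] using e₂
    have hu : u = 0 := by simpa [hp, hq, hC] using e₃
    have hz : z = 0 := by simpa [hu, hv, ha] using h₁
    exact hne ⟨hy, hz, hu, hv⟩
  · exfalso
    have hz : z = 0 := by simpa [hp] using e₁
    have singular_of_root : ∀ D E : F, D ≠ 0 → D - E ≠ 0 → u = D * v →
        p * (b * (2 * u - (D + E) * v)) + q * (C ^ 2 * v) = 0 → False := by
      intro D E hD hDE hu h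
      have hv : v ≠ 0 := by
        rintro rfl
        have hu : u = 0 := by simpa using hu
        have hy : y = 0 := by simpa [hu] using h₂
        exact hne ⟨hy, hz, hu, rfl⟩
      have hy : y ≠ 0 := by
        rintro rfl
        simp [hu, hC, hD, hv] at h₂
      have hq : q = 0 := by simpa [hy] using e₀
      have h' : p * b * (D - E) * v = 0 := by
        rw [hu, hq] at h
        linear_combination h
      simp [hp, hb, hDE, hv] at h'
    have h₀ : (u - A * v) * (u - B * v) = 0 := by simpa [hz, hb] using h₁.symm
    rcases mul_eq_zero.1 h₀ with h | h
    · exact singular_of_root A B hA hAB (sub_eq_zero.1 h) (by linear_combination -e₂)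
    · exact singular_of_root B A hB (sub_ne_zero.2 (sub_ne_zero.1 hAB).symm) (sub_eq_zero.1 h)
        (by linear_combination -e₂)
end

section
/- Let F be a field of characteristic ≠ 2 and a, b, A, B, C ∈ F with a, b, A, B, C and A − B all nonzero, and assume in addition that b²(B − A)² + 2 a b C² (B − A) + 4 a b A C² + a² C⁴ ≠ 0. Then for every nonzero tuple (x, y, z, u, v) ∈ F⁵ satisfying x² − a z² = −b (u − A v)(u − B v) and x² − a y² = −a C² u v, the 2×5 Jacobian matrix of the two polynomials x² − a z² + b(u − Av)(u − Bv) and x² − a y² + a C² u v with respect to (x, y, z, u, v), namely the matrix with rows (2x, 0, −2az, b(2u − (A+B)v), b(2ABv − (A+B)u)) and (2x, −2ay, 0, aC²v, aC²u), has rank 2. -/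
/-- Smoothness of the degree-4 del Pezzo surface
`x² − a z² = −b(u − Av)(u − Bv)`, `x² − a y² = −a C² u v` in ℙ⁴ (Lemma 4.2(3)):
at every nonzero solution the Jacobian matrix has rank 2. -/
theorem stmt5 (F : Type*) [Field F] (hchar : ringChar F ≠ 2)
    (a b A B C : F) (ha : a ≠ 0) (hb : b ≠ 0) (hA : A ≠ 0) (hB : B ≠ 0) (hC : C ≠ 0)
    (hAB : A - B ≠ 0)
    (hdisc : b ^ 2 * (B - A) ^ 2 + 2 * a * b * C ^ 2 * (B - A) + 4 * a * b * A * C ^ 2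
        + a ^ 2 * C ^ 4 ≠ 0) :
    ∀ x y z u v : F, ¬ (x = 0 ∧ y = 0 ∧ z = 0 ∧ u = 0 ∧ v = 0) →
      x ^ 2 - a * z ^ 2 = -(b * ((u - A * v) * (u - B * v))) →
      x ^ 2 - a * y ^ 2 = -(a * C ^ 2 * (u * v)) →
      Matrix.rank
        (!![2 * x, 0, -(2 * a * z), b * (2 * u - (A + B) * v), b * (2 * A * B * v - (A + B) * u);
            2 * x, -(2 * a * y), 0, a * C ^ 2 * v, a * C ^ 2 * u] : Matrix (Fin 2) (Fin 5) F)
        = 2 := by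
  intro x y z u v hne h₁ h₂
  have h2 : (2 : F) ≠ 0 := Ring.two_ne_zero hchar
  have key : ∀ s t : F, (s + t) * x = 0 → t * y = 0 → s * z = 0 →
      s * (b * (2 * u - (A + B) * v)) + t * (a * C ^ 2 * v) = 0 →
      s * (b * (2 * A * B * v - (A + B) * u)) + t * (a * C ^ 2 * u) = 0 → s = 0 ∧ t = 0 := by
    intro s t hx hy hz hu hv
    by_contra hst
    apply hne
    by_cases hs : s = 0
    · subst hs
      have ht : t ≠ 0 := fun h => hst ⟨rfl, h⟩
      obtain rfl : x = 0 := by simpa [ht] using hx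
      obtain rfl : y = 0 := by simpa [ht] using hy
      obtain rfl : v = 0 := by simpa [ht, ha, hC] using hu
      obtain rfl : u = 0 := by simpa [ht, ha, hC] using hv
      obtain rfl : z = 0 := by simpa [ha] using h₁
      simp
    obtain rfl : z = 0 := by simpa [hs] using hz
    by_cases ht : t = 0
    · subst ht
      obtain rfl : x = 0 := by simpa [hs] using hx
      have hu' : 2 * u - (A + B) * v = 0 := by simpa [hs, hb] using hu
      have hv' : 2 * A * B * v - (A + B) * u = 0 := by simpa [hs, hb] using hv
      have hv0 : (A - B) ^ 2 * v = 0 := by linear_combination -(A + B) * hu' - 2 * hv'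
      obtain rfl : v = 0 := by simpa [hAB] using hv0
      obtain rfl : u = 0 := by simpa [h2] using hu'
      obtain rfl : y = 0 := by simpa [ha] using h₂
      simp
    obtain rfl : y = 0 := by simpa [ht] using hy
    by_cases hx0 : x = 0
    · subst hx0
      have huv : u = 0 ∨ v = 0 := by simpa [ha, hC] using h₂
      rcases huv with rfl | rfl
      · obtain rfl : v = 0 := by simpa [hb, hA, hB] using h₁
        simp
      · obtain rfl : u = 0 := by simpa [hb] using h₁
        simp
    · obtain rfl : t = -s := by
        have : s + t = 0 := by simpa [hx0] using hx
        linear_combination this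
      have hu' : b * (2 * u - (A + B) * v) - a * C ^ 2 * v = 0 :=
        mul_left_cancel₀ hs (by linear_combination hu)
      have hv' : b * (2 * A * B * v - (A + B) * u) - a * C ^ 2 * u = 0 :=
        mul_left_cancel₀ hs (by linear_combination hv)
      have hv0 : (b ^ 2 * (B - A) ^ 2 + 2 * a * b * C ^ 2 * (B - A) + 4 * a * b * A * C ^ 2
          + a ^ 2 * C ^ 4) * v = 0 := by
        linear_combination -(a * C ^ 2 + b * (A + B)) * hu' - 2 * b * hv'
      obtain rfl : v = 0 := (mul_eq_zero.mp hv0).resolve_left hdisc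
      obtain rfl : u = 0 := by simpa [h2, hb] using hu'
      exact absurd (by simpa using h₂) hx0
  refine (LinearIndependent.rank_matrix ?_).trans (Fintype.card_fin 2)
  rw [Fintype.linearIndependent_iff]
  intro g hg
  have e := fun j => congrFun hg j
  simp only [Fin.sum_univ_two, Pi.add_apply, Pi.smul_apply, smul_eq_mul, Pi.zero_apply] at e
  have e0 := e 0
  have e1 := e 1
  have e2 := e 2
  have e3 := e 3
  have e4 := e 4
  simp [Matrix.row] at e0 e1 e2 e3 e4
  have := key (g 0) (g 1) (mul_left_cancel₀ h2 (by linear_combination e0))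
    (by simpa [h2, ha] using e1) (by simpa [h2, ha] using e2) e3 e4
  intro i
  fin_cases i
  · exact this.1
  · exact this.2
end

section
/- Assume g is odd. Then for every θ ∈ K one has 4 b² c² D_θ⁴ + 4 a b c C_θ² D_θ² + 4 a b A_θ C_θ² + a² C_θ⁴ ≠ 0, and moreover 4 b² c² D_∞⁴ + 4 a b c C_∞² D_∞² + 4 a b A_∞ C_∞² + a² C_∞⁴ ≠ 0. -/
open NumberField

/-- If `C` and `D` have equal valuation and `A` has valuation at least that of `D²`, then the
term `4b²c²D⁴` strictly dominates at a place where `a` vanishes and `2bc` does not. -/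
theorem Valuation.quartic_ne_zero {F Γ : Type*} [Field F] [LinearOrderedCommGroupWithZero Γ]
    (v : Valuation F Γ) {a b c A C D : F} (ha : v a < 1) (h2 : v 2 = 1) (hb : v b = 1)
    (hc : v c = 1) (hD : D ≠ 0) (hCD : v C = v D) (hA : v A ≤ v D ^ 2) :
    4 * b ^ 2 * c ^ 2 * D ^ 4 + 4 * a * b * c * C ^ 2 * D ^ 2 + 4 * a * b * A * C ^ 2 +
      a ^ 2 * C ^ 4 ≠ 0 := by
  have hD0 : 0 < v D ^ 4 := pow_pos (zero_lt_iff.2 ((v.ne_zero_iff).2 hD)) 4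
  have h4 : v 4 = 1 := by
    rw [show (4 : F) = 2 * 2 by norm_num, map_mul, h2, one_mul]
  have h_bound : v (4 * b * c * C ^ 2 * D ^ 2 + 4 * b * A * C ^ 2 + a * C ^ 4) ≤ v D ^ 4 := by
    refine v.map_add_le (v.map_add_le ?_ ?_) ?_
    · simp only [map_mul, map_pow, h4, hb, hc, hCD, one_mul, ← pow_add]
      exact le_rfl
    · simp only [map_mul, map_pow, h4, hb, hCD, one_mul]
      calc v A * v D ^ 2 ≤ v D ^ 2 * v D ^ 2 := mul_le_mul_left hA _
        _ = v D ^ 4 := by rw [← pow_add]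
    · simp only [map_mul, map_pow, hCD]
      exact mul_le_of_le_one_left' ha.le
  have h_small : v (a * (4 * b * c * C ^ 2 * D ^ 2 + 4 * b * A * C ^ 2 + a * C ^ 4)) <
      v (4 * b ^ 2 * c ^ 2 * D ^ 4) := by
    simp only [map_mul v a, map_mul v _ (D ^ 4), map_mul v _ (c ^ 2), map_mul v _ (b ^ 2),
      map_pow, h4, hb, hc, one_pow, one_mul]
    calc _ ≤ v a * v D ^ 4 := mul_le_mul_right h_bound _
      _ < 1 * v D ^ 4 := mul_lt_mul_of_pos_right ha hD0
      _ = v D ^ 4 := one_mul _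
  have h_eq := v.map_add_eq_of_lt_right h_small
  intro h0
  rw [show a * (4 * b * c * C ^ 2 * D ^ 2 + 4 * b * A * C ^ 2 + a * C ^ 4) +
    4 * b ^ 2 * c ^ 2 * D ^ 4 = 0 by rw [← h0]; ring, map_zero] at h_eq
  exact absurd h_small (h_eq ▸ not_lt_zero)

/-- Subtracting `1` from an element of valuation different from `1`. -/
theorem Valuation.map_sub_one_of_ne_one {F Γ : Type*} [Field F]
    [LinearOrderedCommGroupWithZero Γ] (v : Valuation F Γ) {x : F} (hx : v x ≠ 1) :
    v (x - 1) = max (v x) 1 := by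
  rw [sub_eq_add_neg, v.map_add_of_distinct_val (by simpa using hx), v.map_neg, v.map_one]

/-- A generator of a nonzero prime ideal does not divide a generator of a different one. -/
theorem Ideal.IsPrime.not_dvd_of_span_ne {R : Type*} [CommRing R] [IsDomain R] {p q : R}
    (hp : (Ideal.span {p}).IsPrime) (hq : (Ideal.span {q}).IsPrime) (hp0 : p ≠ 0) (hq0 : q ≠ 0)
    (hpq : Ideal.span {p} ≠ Ideal.span {q}) : ¬ p ∣ q := fun hdvd =>
  hpq <| Ideal.span_singleton_eq_span_singleton.2 <|
    ((Ideal.span_singleton_prime hp0).1 hp).associated_of_dvd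
      ((Ideal.span_singleton_prime hq0).1 hq) hdvd

/-- An element `a ^ odd * θ ^ even` is never a unit at a place where `a` is a uniformizer. -/
theorem Valuation.odd_pow_mul_even_pow_ne_one {F : Type*} [Field F]
    (v : Valuation F (WithZero (Multiplicative ℤ))) {a : F} (ha : v a = WithZero.exp (-1))
    {m n : ℕ} (hm : Odd m) (hn : Even n) (θ : F) : v (a ^ m * θ ^ n) ≠ 1 := by
  obtain ⟨k, rfl⟩ := hm
  obtain ⟨l, rfl⟩ := hn
  intro h1
  have hs : v (a ^ k * θ ^ l) ≠ 0 := by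
    intro h0
    rw [show a ^ (2 * k + 1) * θ ^ (l + l) = a * (a ^ k * θ ^ l) * (a ^ k * θ ^ l) by ring,
      map_mul, h0, mul_zero] at h1
    exact zero_ne_one h1
  obtain ⟨z, hz⟩ : ∃ z : ℤ, v (a ^ k * θ ^ l) = WithZero.exp z :=
    ⟨_, (WithZero.exp_log hs).symm⟩
  rw [show a ^ (2 * k + 1) * θ ^ (l + l) = a * (a ^ k * θ ^ l) * (a ^ k * θ ^ l) by ring,
    map_mul, map_mul, ha, hz, ← WithZero.exp_add, ← WithZero.exp_add, ← WithZero.exp_zero,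
    WithZero.exp_inj] at h1
  omega

/-- The quantity `b²(B_θ−A_θ)² + 2abC_θ²(B_θ−A_θ) + 4abA_θC_θ² + a²C_θ⁴
= 4b²c²D_θ⁴ + 4abcC_θ²D_θ² + 4abA_θC_θ² + a²C_θ⁴` never vanishes for `θ ∈ K ∪ {∞}`
when `g` is odd (the key computation in Proposition 4.3). -/
theorem stmt6 (K : Type*) [Field K] [NumberField K] (h g : ℕ) (hg1 : 1 ≤ g) (hgodd : Odd g)
    (a b c d : 𝓞 K) (hP : GoodParams K a b c d) :
    (∀ θ : K,
      4 * (algebraMap (𝓞 K) K b) ^ 2 * (algebraMap (𝓞 K) K c) ^ 2 *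
          (Dval (algebraMap (𝓞 K) K a) (algebraMap (𝓞 K) K b) h g θ) ^ 4 +
        4 * (algebraMap (𝓞 K) K a) * (algebraMap (𝓞 K) K b) * (algebraMap (𝓞 K) K c) *
          (Cval (algebraMap (𝓞 K) K a) h g θ) ^ 2 *
          (Dval (algebraMap (𝓞 K) K a) (algebraMap (𝓞 K) K b) h g θ) ^ 2 +
        4 * (algebraMap (𝓞 K) K a) * (algebraMap (𝓞 K) K b) *
          (Aval (algebraMap (𝓞 K) K a) (algebraMap (𝓞 K) K b) (algebraMap (𝓞 K) K c)
            (algebraMap (𝓞 K) K d) h g θ) *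
          (Cval (algebraMap (𝓞 K) K a) h g θ) ^ 2 +
        (algebraMap (𝓞 K) K a) ^ 2 * (Cval (algebraMap (𝓞 K) K a) h g θ) ^ 4 ≠ 0) ∧
    (4 * (algebraMap (𝓞 K) K b) ^ 2 * (algebraMap (𝓞 K) K c) ^ 2 *
          (Dinf (algebraMap (𝓞 K) K a) (algebraMap (𝓞 K) K b) h) ^ 4 +
        4 * (algebraMap (𝓞 K) K a) * (algebraMap (𝓞 K) K b) * (algebraMap (𝓞 K) K c) *
          (Cinf (algebraMap (𝓞 K) K a) h) ^ 2 *
          (Dinf (algebraMap (𝓞 K) K a) (algebraMap (𝓞 K) K b) h) ^ 2 +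
        4 * (algebraMap (𝓞 K) K a) * (algebraMap (𝓞 K) K b) *
          (Ainf (algebraMap (𝓞 K) K a) (algebraMap (𝓞 K) K b) (algebraMap (𝓞 K) K c)
            (algebraMap (𝓞 K) K d) h) *
          (Cinf (algebraMap (𝓞 K) K a) h) ^ 2 +
        (algebraMap (𝓞 K) K a) ^ 2 * (Cinf (algebraMap (𝓞 K) K a) h) ^ 4 ≠ 0) := by
  obtain ⟨hap, hbp, hcp, -, ha0, hb0, hc0, -, hab, hac, -, -, -, -, ha2, -⟩ := hP
  let w : IsDedekindDomain.HeightOneSpectrum (𝓞 K) :=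
    ⟨Ideal.span {a}, hap, by simpa using ha0⟩
  let v := w.valuation K
  have h_unit (x : 𝓞 K) (hx : ¬ a ∣ x) : v (algebraMap (𝓞 K) K x) = 1 := by
    refine le_antisymm (w.valuation_le_one x) (not_lt.1 fun hlt => hx ?_)
    exact Ideal.span_singleton_le_span_singleton.1
      (Ideal.dvd_iff_le.1 ((w.valuation_lt_one_iff_dvd x).1 hlt))
  have hva : v (algebraMap (𝓞 K) K a) = WithZero.exp (-1) :=
    (w.valuation_of_algebraMap a).trans (w.intValuation_singleton ha0 rfl)
  have hva1 : v (algebraMap (𝓞 K) K a) < 1 := by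
    rw [hva, ← WithZero.exp_zero, WithZero.exp_lt_exp]
    norm_num
  have hvb := h_unit b (hap.not_dvd_of_span_ne hbp ha0 hb0 hab)
  have hvc := h_unit c (hap.not_dvd_of_span_ne hcp ha0 hc0 hac)
  have hv2 : v 2 = 1 := map_ofNat (algebraMap (𝓞 K) K) 2 ▸ h_unit 2 ha2
  have hvd : v (algebraMap (𝓞 K) K d) ≤ 1 := w.valuation_le_one d
  have haK : algebraMap (𝓞 K) K a ≠ 0 := by simpa using ha0
  have hbK : algebraMap (𝓞 K) K b ≠ 0 := by simpa using hb0
  generalize algebraMap (𝓞 K) K a = a at *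
  generalize algebraMap (𝓞 K) K b = b at *
  generalize algebraMap (𝓞 K) K c = c at *
  generalize algebraMap (𝓞 K) K d = d at *
  have hA {x D : K} (hx : v x ≤ v D) : v (a * x ^ 2 + b * c ^ 2 * d * D ^ 2) ≤ v D ^ 2 := by
    refine v.map_add_le ?_ ?_
    · rw [map_mul, map_pow]
      exact (mul_le_of_le_one_left' hva1.le).trans (pow_le_pow_left' hx 2)
    · simp only [map_mul, map_pow, hvb, hvc, one_pow, one_mul]
      exact mul_le_of_le_one_left' hvd
  refine ⟨fun θ => ?_, ?_⟩
  · have hx : v (a ^ (2 * h + 1) * θ ^ (g + 1)) ≠ 1 :=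
      v.odd_pow_mul_even_pow_ne_one hva ⟨h, rfl⟩ hgodd.add_one θ
    have hbx : v (a ^ (2 * h + 1) * b ^ (2 * h + 1) * θ ^ (g + 1)) =
        v (a ^ (2 * h + 1) * θ ^ (g + 1)) := by
      simp only [map_mul, map_pow, hvb, one_pow, mul_one]
    have hvD : v (Dval a b h g θ) = max (v (a ^ (2 * h + 1) * θ ^ (g + 1))) 1 := by
      rw [Dval, v.map_sub_one_of_ne_one (hbx ▸ hx), hbx]
    refine v.quartic_ne_zero hva1 hv2 hvb hvc ?_ ?_ ?_
    · refine v.ne_zero_iff.1 (hvD ▸ (lt_max_of_lt_right zero_lt_one).ne')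
    · rw [hvD, Cval, v.map_sub_one_of_ne_one hx]
    · rw [Aval, show a ^ (4 * h + 3) * θ ^ (2 * g + 2) =
        a * (a ^ (2 * h + 1) * θ ^ (g + 1)) ^ 2 by ring]
      exact hA (hvD ▸ le_max_left _ _)
  · have hvD : v (Dinf a b h) = v (a ^ (2 * h + 1)) := by
      simp only [Dinf, map_mul, map_pow, hvb, one_pow, mul_one]
    refine v.quartic_ne_zero hva1 hv2 hvb hvc ?_ hvD.symm ?_
    · exact mul_ne_zero (pow_ne_zero _ haK) (pow_ne_zero _ hbK)
    · rw [Ainf, show a ^ (4 * h + 3) = a * (a ^ (2 * h + 1)) ^ 2 by ring]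
      exact hA hvD.ge
end

section
/- Let g ≥ 1 be an integer and 𝔽 a finite field of characteristic p > 4g². Let 𝔞, 𝔟, 𝔯 ∈ 𝔽 be nonzero. Then there exist S, T ∈ 𝔽 with 𝔞 S² = 𝔟 (1 − 𝔯 T^{g+1}) and (S, T) ≠ (0, 0) (equivalently, the affine curve 𝔞 S² = 𝔟 (1 − 𝔯 T^{g+1}) has a smooth 𝔽-point). -/
open Finset in
/-- For distinct nonzero `s, t`, an affine substitution turns this sum into a Jacobi sum. -/
lemma quadraticChar_sum_one_sub_mul_of_ne {F : Type*} [Field F] [Fintype F] [DecidableEq F]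
    (hF : ringChar F ≠ 2) {s t : F} (hs : s ≠ 0) (ht : t ≠ 0) (hst : s ≠ t) :
    ∑ u : F, quadraticChar F (1 - u * s) * quadraticChar F (1 - u * t) =
      -(quadraticChar F s * quadraticChar F t) := by
  have hd : t - s ≠ 0 := sub_ne_zero.mpr hst.symm
  have hJ := jacobiSum_nontrivial_inv (quadraticChar_ne_one hF)
  rw [(quadraticChar_isQuadratic F).inv] at hJ
  have hbij : Function.Bijective fun u : F ↦ t / (t - s) * (1 - u * s) := by
    refine Finite.injective_iff_bijective.mp fun u v huv ↦ ?_
    have h := mul_left_cancel₀ (div_ne_zero ht hd) huv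
    exact mul_right_cancel₀ hs (sub_right_injective h)
  have hsum : jacobiSum (quadraticChar F) (quadraticChar F) =
      quadraticChar F (t / (t - s) * (-s / (t - s))) *
        ∑ u : F, quadraticChar F (1 - u * s) * quadraticChar F (1 - u * t) := by
    rw [jacobiSum, ← hbij.sum_comp, mul_sum]
    refine sum_congr rfl fun u _ ↦ ?_
    have h1 : 1 - t / (t - s) * (1 - u * s) = -s / (t - s) * (1 - u * t) := by
      field_simp
      ring
    rw [h1]
    simp only [map_mul]
    ring
  have hq : quadraticChar F (t / (t - s) * (-s / (t - s))) =
      quadraticChar F (-1) * (quadraticChar F s * quadraticChar F t) := by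
    have h1 : t / (t - s) * (-s / (t - s)) = -1 * (s * t) * ((t - s)⁻¹) ^ 2 := by
      field_simp
    rw [h1, map_mul, quadraticChar_sq_one' (inv_ne_zero hd)]
    simp only [map_mul, mul_one]
  rw [hq, hJ] at hsum
  have e1 := quadraticChar_sq_one (neg_ne_zero.mpr (one_ne_zero (α := F)))
  have e2 := quadraticChar_sq_one hs
  have e3 := quadraticChar_sq_one ht
  set a := quadraticChar F (-1)
  set b := quadraticChar F s
  set c := quadraticChar F t
  set K := ∑ u : F, quadraticChar F (1 - u * s) * quadraticChar F (1 - u * t)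
  linear_combination (-a * b * c) * hsum + (-b * c - b ^ 2 * c ^ 2 * K) * e1 -
    c ^ 2 * K * e2 - K * e3

open Finset in
/-- Orthogonality-type relation for the quadratic character along a pencil of lines. -/
lemma quadraticChar_sum_one_sub_mul {F : Type*} [Field F] [Fintype F] [DecidableEq F]
    (hF : ringChar F ≠ 2) (s t : F) :
    ∑ u : F, quadraticChar F (1 - u * s) * quadraticChar F (1 - u * t) =
      (if s = t then (Fintype.card F : ℤ) else 0) - quadraticChar F s * quadraticChar F t := by
  have hlin : ∀ v : F, v ≠ 0 → ∑ u : F, quadraticChar F (1 - u * v) = 0 := fun v hv ↦ by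
    have hbij : Function.Bijective fun u : F ↦ 1 - u * v :=
      Finite.injective_iff_bijective.mp fun u w huw ↦
        mul_right_cancel₀ hv (sub_right_injective huw)
    rw [hbij.sum_comp fun x ↦ quadraticChar F x]
    exact quadraticChar_sum_zero hF
  by_cases hst : s = t
  · subst hst
    by_cases hs : s = 0
    · simp [hs]
    · have hterm : ∀ u : F, quadraticChar F (1 - u * s) * quadraticChar F (1 - u * s) =
          1 - if u = s⁻¹ then 1 else 0 := fun u ↦ by
        split_ifs with h
        · simp [h, hs]
        · have h' : 1 - u * s ≠ 0 := fun h0 ↦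
            h (eq_inv_of_mul_eq_one_left (sub_eq_zero.mp h0).symm)
          rw [← sq, quadraticChar_sq_one h', sub_zero]
      simp only [hterm, sum_sub_distrib, ← sq, quadraticChar_sq_one hs]
      simp
  · by_cases hs : s = 0
    · have ht : t ≠ 0 := fun h ↦ hst (hs.trans h.symm)
      simpa [hs, ht.symm] using hlin t ht
    · by_cases ht : t = 0
      · simpa [ht, hs] using hlin s hs
      · rw [quadraticChar_sum_one_sub_mul_of_ne hF hs ht hst]
        simp [hst]

open Finset in
lemma card_filter_pow_eq_le {F : Type*} [Field F] [Fintype F] [DecidableEq F] {d : ℕ}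
    (hd : 0 < d) (a : F) : #{x : F | x ^ d = a} ≤ d := by
  calc #{x : F | x ^ d = a} ≤ #(Polynomial.nthRootsFinset d a) :=
        card_le_card fun x hx ↦ by
          rw [Polynomial.mem_nthRootsFinset hd]
          exact (mem_filter.mp hx).2
    _ ≤ (Polynomial.nthRoots d a).card := by
        rw [Polynomial.nthRootsFinset_def]
        exact Multiset.toFinset_card_le _
    _ ≤ d := Polynomial.card_nthRoots d a

open Finset in
/-- Second moment bound for the character sums `∑ₓ χ(1 - u x ^ d)`. -/
lemma sum_sq_sum_quadraticChar_one_sub_mul_pow_le {F : Type*} [Field F] [Fintype F]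
    [DecidableEq F] (hF : ringChar F ≠ 2) {d : ℕ} (hd : 0 < d) :
    ∑ u : F, (∑ x : F, quadraticChar F (1 - u * x ^ d)) ^ 2 ≤
      (Fintype.card F : ℤ) * (1 + (Fintype.card F - 1) * d) := by
  have hcount : ∑ x : F, ∑ y : F, (if x ^ d = y ^ d then (1 : ℤ) else 0) ≤
      1 + (Fintype.card F - 1) * d := by
    rw [← add_sum_erase _ _ (mem_univ (0 : F))]
    refine add_le_add ?_ ?_
    · simp [zero_pow hd.ne', eq_comm (a := (0 : F)), hd.ne']
    · have hle := sum_le_card_nsmul (univ.erase (0 : F))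
        (fun x ↦ ∑ y : F, (if x ^ d = y ^ d then (1 : ℤ) else 0)) d fun x _ ↦ by
          rw [sum_boole]
          simpa only [eq_comm] using Nat.cast_le.mpr (card_filter_pow_eq_le hd (x ^ d))
      rw [card_erase_of_mem (mem_univ _), card_univ, nsmul_eq_mul,
        Nat.cast_sub Fintype.card_pos, Nat.cast_one] at hle
      exact hle
  calc ∑ u : F, (∑ x : F, quadraticChar F (1 - u * x ^ d)) ^ 2
      = ∑ x : F, ∑ y : F, ∑ u : F,
          quadraticChar F (1 - u * x ^ d) * quadraticChar F (1 - u * y ^ d) := by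
        simp only [sq, sum_mul_sum]
        rw [sum_comm]
        exact sum_congr rfl fun x _ ↦ sum_comm
    _ = Fintype.card F * (∑ x : F, ∑ y : F, (if x ^ d = y ^ d then (1 : ℤ) else 0)) -
          (∑ x : F, quadraticChar F (x ^ d)) ^ 2 := by
        simp only [quadraticChar_sum_one_sub_mul hF, sum_sub_distrib, sq, sum_mul_sum]
        simp only [mul_sum, mul_ite, mul_one, mul_zero]
    _ ≤ Fintype.card F * (∑ x : F, ∑ y : F, (if x ^ d = y ^ d then (1 : ℤ) else 0)) :=
        sub_le_self _ (sq_nonneg _)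
    _ ≤ _ := mul_le_mul_of_nonneg_left hcount (Nat.cast_nonneg _)

open Finset in
lemma sum_comp_mul_pow_le {F : Type*} [Field F] [Fintype F] [DecidableEq F] {d : ℕ}
    (hd : 0 < d) {r : F} (hr : r ≠ 0) (f : F → ℤ) (hf : ∀ u, 0 ≤ f u) :
    ∑ x ∈ univ.erase (0 : F), f (r * x ^ d) ≤ d * ∑ u ∈ univ.erase (0 : F), f u := by
  have hmaps : ∀ x ∈ univ.erase (0 : F), r * x ^ d ∈ univ.erase (0 : F) := fun x hx ↦ by
    simpa [hr, hd.ne'] using hx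
  rw [← sum_fiberwise_of_maps_to hmaps, mul_sum]
  refine sum_le_sum fun u _ ↦ ?_
  rw [sum_congr rfl fun x hx ↦ by rw [(mem_filter.mp hx).2], sum_const, nsmul_eq_mul]
  refine mul_le_mul_of_nonneg_right (Nat.cast_le.mpr ?_) (hf u)
  refine (card_le_card fun x hx ↦ ?_).trans (card_filter_pow_eq_le hd (r⁻¹ * u))
  rw [mem_filter] at hx ⊢
  exact ⟨mem_univ x, by rw [← hx.2, inv_mul_cancel_left₀ hr]⟩

open Finset in
/-- A diagonal curve `s² = c (1 - r t ^ d)` over a finite field with more than `d (d - 1)`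
elements has a rational point. -/
lemma exists_isSquare_mul_one_sub_mul_pow {F : Type*} [Field F] [Fintype F]
    (hF : ringChar F ≠ 2) {d : ℕ} (hd : 0 < d)
    (hcard : (d : ℤ) * (d - 1) < Fintype.card F) {c r : F} (hc : c ≠ 0) (hr : r ≠ 0) :
    ∃ t : F, IsSquare (c * (1 - r * t ^ d)) := by
  classical
  by_contra! hns
  set A : F → ℤ := fun u ↦ ∑ x : F, quadraticChar F (1 - u * x ^ d) with hA
  set q : ℤ := (Fintype.card F : ℤ) with hq
  have hq1 : 1 < q := Nat.one_lt_cast.mpr Fintype.one_lt_card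
  have hA0 : A 0 = q := by simp [hA, hq]
  have hAr : ∀ t : F, A (r * t ^ d) ^ 2 = q ^ 2 := fun t ↦ by
    have hval : A (r * t ^ d) = q * -quadraticChar F c := by
      rw [hA, hq, ← nsmul_eq_mul, ← card_univ, ← sum_const]
      refine sum_congr rfl fun x _ ↦ ?_
      have h := quadraticChar_neg_one_iff_not_isSquare.mpr (hns (t * x))
      rw [map_mul, mul_pow, ← mul_assoc] at h
      linear_combination quadraticChar F c * h -
        quadraticChar F (1 - r * t ^ d * x ^ d) * quadraticChar_sq_one hc
    rw [hval, mul_pow, neg_sq, quadraticChar_sq_one hc, mul_one]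
  have hmoment := sum_sq_sum_quadraticChar_one_sub_mul_pow_le hF hd
  rw [← add_sum_erase _ _ (mem_univ (0 : F))] at hmoment
  have hfib := sum_comp_mul_pow_le hd hr (fun u ↦ A u ^ 2) fun u ↦ sq_nonneg _
  simp only [hAr] at hfib
  rw [sum_const, card_erase_of_mem (mem_univ _), card_univ, nsmul_eq_mul,
    Nat.cast_sub Fintype.card_pos, Nat.cast_one] at hfib
  change A 0 ^ 2 + ∑ u ∈ univ.erase (0 : F), A u ^ 2 ≤ q * (1 + (q - 1) * d) at hmoment
  rw [hA0] at hmoment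
  have hle : (q - 1) * q ^ 2 ≤ d * (q * (q - 1) * (d - 1)) :=
    hfib.trans (mul_le_mul_of_nonneg_left (by linarith) (Nat.cast_nonneg d))
  have hpos : 0 < q * (q - 1) := mul_pos (by linarith) (by linarith)
  nlinarith [mul_lt_mul_of_pos_left hcard hpos]

/-- Lemma 5.3: over a finite field `𝔽` of characteristic `p > 4g²`, the affine curve
`𝔞 S² = 𝔟 (1 − 𝔯 T^{g+1})` (with `𝔞, 𝔟, 𝔯 ≠ 0`) possesses a smooth `𝔽`-point. -/
theorem stmt8 (F : Type*) [Field F] [Fintype F] (g : ℕ) (hg : 1 ≤ g)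
    (hp : 4 * g ^ 2 < ringChar F)
    (fa fb fr : F) (ha : fa ≠ 0) (hb : fb ≠ 0) (hr : fr ≠ 0) :
    ∃ S T : F, fa * S ^ 2 = fb * (1 - fr * T ^ (g + 1)) ∧ ¬ (S = 0 ∧ T = 0) := by
  have hF : ringChar F ≠ 2 := by nlinarith
  have hle : ringChar F ≤ Fintype.card F :=
    Nat.le_of_dvd Fintype.card_pos (ringChar.dvd (FiniteField.cast_card_eq_zero F))
  have hcard : ((g + 1 : ℕ) : ℤ) * ((g + 1 : ℕ) - 1) < Fintype.card F := by
    have h : (g + 1) * g < Fintype.card F := by nlinarith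
    push_cast
    rw [add_sub_cancel_right]
    exact_mod_cast h
  obtain ⟨T, S, hS⟩ :=
    exists_isSquare_mul_one_sub_mul_pow hF g.succ_pos hcard (div_ne_zero hb ha) hr
  refine ⟨S, T, ?_, ?_⟩
  · rw [sq, ← hS]
    field_simp
  · rintro ⟨rfl, rfl⟩
    simp [ha, hb] at hS
end

section
/- Assume g is odd and g+1 divides 4h+2. Then for every place v of K (finite or archimedean), every finite field extension L of the completion K_v, and every θ ∈ L ∪ {∞}, the curve X_θ has an L-point: there exist (s, t) ∈ L² with a s² = b (t^{g+1} − A_θ)(t^{g+1} − B_θ), or (S, T) ∈ L² with a S² = b (1 − A_θ T^{g+1})(1 − B_θ T^{g+1}). In other words, the map X(L) → ℙ¹(L) induced by the family is surjective for every local field L containing K. -/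
open NumberField IsDedekindDomain

universe u

/-- The image of `x ∈ 𝓞 K` in the completion of `K` at the finite place `π`. -/
noncomputable def intToAdicCompletion {K : Type*} [Field K] [NumberField K]
    (π : HeightOneSpectrum (𝓞 K)) (x : 𝓞 K) : π.adicCompletion K :=
  algebraMap K (π.adicCompletion K) (algebraMap (𝓞 K) K x)

/-- The arithmetic parameters `a, b, c, d` of Proposition 2.1 of Huang–Liang, for the
finite set `Ω⁰` of finite odd places of residue characteristic at most `4g²`;
`va, vb, vc, vd` are the finite places of `K` generated by `a, b, c, d`. -/
structure Params (K : Type u) [Field K] [NumberField K] (g : ℕ) (a b c d : 𝓞 K)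
    (va vb vc vd : HeightOneSpectrum (𝓞 K)) : Prop where
  span_a : va.asIdeal = Ideal.span {a}
  span_b : vb.asIdeal = Ideal.span {b}
  span_c : vc.asIdeal = Ideal.span {c}
  span_d : vd.asIdeal = Ideal.span {d}
  distinct : va ≠ vb ∧ va ≠ vc ∧ va ≠ vd ∧ vb ≠ vc ∧ vb ≠ vd ∧ vc ≠ vd
  not_dvd_two : (2 : 𝓞 K) ∉ va.asIdeal ∧ (2 : 𝓞 K) ∉ vb.asIdeal ∧
    (2 : 𝓞 K) ∉ vc.asIdeal ∧ (2 : 𝓞 K) ∉ vd.asIdeal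
  char_odd : Odd (ringChar (𝓞 K ⧸ va.asIdeal)) ∧ Odd (ringChar (𝓞 K ⧸ vb.asIdeal)) ∧
    Odd (ringChar (𝓞 K ⧸ vc.asIdeal)) ∧ Odd (ringChar (𝓞 K ⧸ vd.asIdeal))
  char_big : 4 * g ^ 2 < ringChar (𝓞 K ⧸ va.asIdeal) ∧
    4 * g ^ 2 < ringChar (𝓞 K ⧸ vb.asIdeal) ∧
    4 * g ^ 2 < ringChar (𝓞 K ⧸ vc.asIdeal) ∧
    4 * g ^ 2 < ringChar (𝓞 K ⧸ vd.asIdeal)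
  sq_ab_bad : ∀ π : HeightOneSpectrum (𝓞 K),
    ((2 : 𝓞 K) ∈ π.asIdeal ∨ ringChar (𝓞 K ⧸ π.asIdeal) ≤ 4 * g ^ 2) →
    IsSquare (intToAdicCompletion π a) ∧ IsSquare (intToAdicCompletion π b)
  pos_real : ∀ σ : K →+* ℝ, 0 < σ (algebraMap (𝓞 K) K a) ∧ 0 < σ (algebraMap (𝓞 K) K b)
  sq_two_a : IsSquare ((2 : va.adicCompletion K))
  sq_neg_one_a : IsSquare ((-1 : va.adicCompletion K))
  sq_two_b : IsSquare ((2 : vb.adicCompletion K))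
  sq_neg_one_b : IsSquare ((-1 : vb.adicCompletion K))
  cong_a : b ∣ a - 1
  cong_bcd : a ∣ b * c ^ 2 * d - 1
  c_nsq_a : ¬ IsSquare (intToAdicCompletion va c)
  c_nsq_b : ¬ IsSquare (intToAdicCompletion vb c)
  d_nsq_b : ¬ IsSquare (intToAdicCompletion vb d)
  d_sq_c : IsSquare (intToAdicCompletion vc d)
  d_sq_a : IsSquare (intToAdicCompletion va d)
  a_sq_b : IsSquare (intToAdicCompletion vb a)
  a_nsq_c : ¬ IsSquare (intToAdicCompletion vc a)
  b_sq_a : IsSquare (intToAdicCompletion va b)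
  b_nsq_c : ¬ IsSquare (intToAdicCompletion vc b)
  not_dvd : ¬ a ∣ b * c * d + 2

/-- The hyperelliptic curve with parameters `A, B` has an `L`-point: one of the two
affine charts `a s² = b (t^{g+1} − A)(t^{g+1} − B)`,
`a S² = b (1 − A T^{g+1})(1 − B T^{g+1})` has a solution. -/
def XPoint {L : Type*} [Field L] (g : ℕ) (a b A B : L) : Prop :=
  (∃ s t : L, a * s ^ 2 = b * ((t ^ (g + 1) - A) * (t ^ (g + 1) - B))) ∨
  (∃ S T : L, a * S ^ 2 = b * ((1 - A * T ^ (g + 1)) * (1 - B * T ^ (g + 1))))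

/-- The fibers `X_θ` for all `θ ∈ L ∪ {∞}` have `L`-points. -/
def XAllFibers {L : Type*} [Field L] (h g : ℕ) (a b c d : L) : Prop :=
  (∀ θ : L, XPoint g a b (Aval a b c d h g θ) (Bval a b c d h g θ)) ∧
  XPoint g a b (Ainf a b c d h) (Binf a b c d h)

/-- The image of `x ∈ 𝓞 K` in a field extension `L` of the completion `K_π`. -/
noncomputable def intToLocalExt {K : Type u} [Field K] [NumberField K]
    (π : HeightOneSpectrum (𝓞 K)) (L : Type u) [Field L]
    [Algebra (π.adicCompletion K) L] (x : 𝓞 K) : L :=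
  algebraMap (π.adicCompletion K) L (intToAdicCompletion π x)

section Stepanov

open Polynomial

variable {F : Type*} [Field F]

/-- The partial Taylor sums of `u` at increments `w` with `w' = -1` have telescoping derivative. -/
lemma derivative_sum_hasseDeriv_mul_pow (u w : F[X]) (hw : derivative w = -1) (m : ℕ) :
    derivative (∑ k ∈ Finset.range (m + 1), hasseDeriv k u * w ^ k) =
      (m + 1 : ℕ) • hasseDeriv (m + 1) u * w ^ m := by
  have hd (k : ℕ) : derivative (hasseDeriv k u) = (k + 1 : ℕ) • hasseDeriv (k + 1) u := by
    have h := LinearMap.congr_fun (hasseDeriv_comp (R := F) 1 k) u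
    simpa [hasseDeriv_one, add_comm, add_mul] using h
  induction m with
  | zero => simp [hasseDeriv_one, hasseDeriv_zero]
  | succ m ih =>
    rw [Finset.sum_range_succ, derivative_add, ih, derivative_mul, hd, derivative_pow, hw]
    simp only [nsmul_eq_mul, add_tsub_cancel_right, map_natCast]
    push_cast
    ring

/-- If `G ∣ X ^ q - X`, then a polynomial vanishing at the roots of `G` whose derivative is
divisible by `(X ^ q - X) ^ α` is divisible by `G ^ (α + 1)`. -/
lemma pow_succ_dvd_of_pow_dvd_derivative {p q α : ℕ} [CharP F p] (hpq : p ∣ q) (hα : α < p)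
    {G V : F[X]} (hG : G ∣ X ^ q - X) (h0 : G ∣ V)
    (hV : (X ^ q - X) ^ α ∣ derivative V) : G ^ (α + 1) ∣ V := by
  have hsep : G.Separable := (galois_poly_separable p q hpq).of_dvd hG
  have key : ∀ j ≤ α, G ^ (j + 1) ∣ V := by
    intro j
    induction j with
    | zero => intro _; simpa using h0
    | succ j ih =>
      intro hj
      obtain ⟨W, hW⟩ := ih (by lia)
      have h1 : G ^ (j + 1) ∣ derivative V :=
        (pow_dvd_pow G hj).trans ((pow_dvd_pow_of_dvd hG α).trans hV)
      have hG0 : G ≠ 0 := hsep.ne_zero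
      rw [hW, derivative_mul, derivative_pow, add_tsub_cancel_right,
        show C ((j + 1 : ℕ) : F) * G ^ j * derivative G * W + G ^ (j + 1) * derivative W =
          G ^ j * (C ((j + 1 : ℕ) : F) * (derivative G * W) + G * derivative W) by ring,
        pow_succ, mul_dvd_mul_iff_left (pow_ne_zero j hG0)] at h1
      have h2 := (dvd_add_left (dvd_mul_right G (derivative W))).mp h1
      have h3 : IsUnit (C ((j + 1 : ℕ) : F)) := by
        refine isUnit_C.mpr (IsUnit.mk0 _ fun h => ?_)
        rw [CharP.cast_eq_zero_iff F p] at h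
        have := Nat.le_of_dvd (by lia) h
        lia
      have h4 := IsCoprime.dvd_of_dvd_mul_left hsep (h3.dvd_mul_left.mp h2)
      rw [hW, pow_succ _ (j + 1)]
      exact mul_dvd_mul_left _ h4
  exact key α le_rfl

/-- The leading behaviour, modulo `f`, of the iterated derivatives of a power of `f`. -/
lemma exists_iterate_derivative_pow_eq (f : F[X]) (N k : ℕ) (hk : k ≤ N) :
    ∃ Q R : F[X], derivative^[k] (f ^ N) = f ^ (N - k) * Q ∧
      Q = C (∏ i ∈ Finset.range k, ((N : F) - i)) * derivative f ^ k + f * R := by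
  induction k with
  | zero => exact ⟨1, 0, by simp⟩
  | succ k ih =>
    obtain ⟨Q, R, h1, h2⟩ := ih (by lia)
    obtain ⟨m, hm⟩ : ∃ m, N - k = m + 1 := ⟨N - k - 1, by lia⟩
    have hm' : (N : F) - k = (m + 1 : ℕ) := by
      rw [← hm, Nat.cast_sub (by lia)]
    refine ⟨C ((m + 1 : ℕ) : F) * derivative f * Q + f * derivative Q,
      C ((m + 1 : ℕ) : F) * derivative f * R + derivative Q, ?_, ?_⟩
    · rw [Function.iterate_succ_apply', h1, hm, derivative_mul, derivative_pow,
        show N - (k + 1) = m by lia, add_tsub_cancel_right]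
      ring
    · rw [Finset.prod_range_succ, hm', h2, C_mul]
      ring

lemma iterate_derivative_pow_ne_zero {f : F[X]} (hf : f.Separable) (hu : ¬ IsUnit f) {N k : ℕ}
    (hk : k ≤ N) (hc : ∀ i < k, (N : F) - i ≠ 0) : derivative^[k] (f ^ N) ≠ 0 := by
  intro h
  obtain ⟨Q, R, h1, h2⟩ := exists_iterate_derivative_pow_eq f N k hk
  have hf0 : f ≠ 0 := hf.ne_zero
  have hQ : Q = 0 := by
    rw [h1] at h
    exact (mul_eq_zero.mp h).resolve_left (pow_ne_zero _ hf0)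
  have hc' : (∏ i ∈ Finset.range k, ((N : F) - i)) ≠ 0 :=
    Finset.prod_ne_zero_iff.mpr fun i hi => hc i (Finset.mem_range.mp hi)
  have hdvd : f ∣ C (∏ i ∈ Finset.range k, ((N : F) - i)) * derivative f ^ k :=
    ⟨-R, by linear_combination hQ - h2⟩
  have hdvd' : f ∣ derivative f ^ k :=
    ((isUnit_C.mpr hc'.isUnit).dvd_mul_left).mp hdvd
  exact hu ((IsCoprime.pow_right (n := k) hf).isUnit_of_dvd' dvd_rfl hdvd')

/-- Stepanov's bound: a separable polynomial `f` of degree `2 α` over a finite field cannot take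
nonzero square values too often. -/
theorem stepanov_bound {p q r α : ℕ} [CharP F p] (hpq : p ∣ q) (hqr : q = 2 * r + 1)
    (hq : 1 < q) (hp : p.Prime) (hα : 0 < α) (hαp : 2 * α < p) {f G : F[X]} (hf : f.Separable)
    (hdeg : f.natDegree = 2 * α) (hG : G ∣ X ^ q - X) (hGf : G ∣ f ^ r - 1) :
    (α + 1) * G.natDegree + α * (q + 1) ≤ 2 * α * q + 2 * α ^ 2 := by
  have hpq' : p ≤ q := Nat.le_of_dvd (by lia) hpq
  have hq0 : (q : F[X]) = 0 := by
    rw [CharP.cast_eq_zero_iff F[X] p]; exact hpq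
  have hq0' : (q : F) = 0 := by
    rw [CharP.cast_eq_zero_iff F p]; exact hpq
  set w : F[X] := X ^ q - X with hw
  have hdw : derivative w = -1 := by
    simp [hw, derivative_X_pow, hq0']
  set u : F[X] := f ^ (r + 1) with hu
  set V : F[X] := f ^ q - ∑ k ∈ Finset.range (α + 1), hasseDeriv k u * w ^ k with hV
  have hdV : derivative V = -((α + 1 : ℕ) • hasseDeriv (α + 1) u * w ^ α) := by
    rw [hV, derivative_sub, derivative_sum_hasseDeriv_mul_pow u w hdw, derivative_pow]
    simp [hq0']
  have hunit : ¬ IsUnit f := by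
    intro h
    have := natDegree_eq_zero_of_isUnit h
    lia
  have hfact (k : ℕ) (hk : k < p) : ((k.factorial : ℕ) : F[X]) ≠ 0 := by
    rw [Ne, CharP.cast_eq_zero_iff F[X] p, hp.dvd_factorial]
    lia
  have hfu (k : ℕ) : ((k.factorial : ℕ) : F[X]) * hasseDeriv k u = derivative^[k] u := by
    rw [← factorial_smul_hasseDeriv]
    simp
  have hVne : V ≠ 0 := by
    intro h0
    rw [h0, derivative_zero, eq_comm, neg_eq_zero, mul_eq_zero] at hdV
    have hw0 : w ^ α ≠ 0 := by
      refine pow_ne_zero _ fun h => ?_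
      rw [h] at hdw
      simp at hdw
    have h1 := hdV.resolve_right hw0
    have h2 : derivative^[α + 1] u = 0 := by
      rw [← hfu, Nat.factorial_succ]
      push_cast
      rw [nsmul_eq_mul] at h1
      push_cast at h1
      linear_combination (α.factorial : F[X]) * h1
    refine iterate_derivative_pow_ne_zero hf hunit (by lia) (fun i hi h => ?_) h2
    have h3 : ((2 * (i : ℤ) - 1 : ℤ) : F) = 0 := by
      have h4 : (q : F) = 2 * r + 1 := by rw [hqr]; push_cast; ring
      push_cast at h ⊢
      linear_combination (-2) * h + hq0' - h4
    rw [CharP.intCast_eq_zero_iff F p] at h3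
    rcases Nat.eq_zero_or_pos i with rfl | hi0
    · have := Int.le_of_dvd (by norm_num) ((dvd_neg).mpr h3)
      have := hp.two_le
      lia
    · have := Int.le_of_dvd (by lia) h3
      lia
  have hG0 : G ∣ V := by
    rw [hV, Finset.sum_range_succ']
    have h1 : G ∣ f ^ q - hasseDeriv 0 u * w ^ 0 := by
      have : f ^ q - hasseDeriv 0 u * w ^ 0 = f ^ (r + 1) * (f ^ r - 1) := by
        simp [hasseDeriv_zero, hu, hqr]
        ring
      rw [this]
      exact hGf.mul_left _
    have h2 : G ∣ ∑ k ∈ Finset.range α, hasseDeriv (k + 1) u * w ^ (k + 1) :=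
      Finset.dvd_sum fun k _ => (hG.trans (dvd_pow_self w k.succ_ne_zero)).mul_left _
    convert dvd_sub h1 h2 using 1
    ring
  have hGV : G ^ (α + 1) ∣ V :=
    pow_succ_dvd_of_pow_dvd_derivative hpq (by lia) hG hG0 (hdV ▸ (dvd_mul_left _ _).neg_right)
  have hfV : f ^ (r + 1 - α) ∣ V := by
    refine dvd_sub (pow_dvd_pow f (by lia)) (Finset.dvd_sum fun k hk => Dvd.dvd.mul_right ?_ _)
    have hk' : k ≤ α := by simpa [Nat.lt_succ_iff] using hk
    have h1 : f ^ (r + 1 - α) ∣ ((k.factorial : ℕ) : F[X]) * hasseDeriv k u := by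
      rw [hfu]
      exact (pow_dvd_pow f (by lia)).trans (pow_sub_dvd_iterate_derivative_pow f (r + 1) k)
    have h2 : IsUnit ((k.factorial : ℕ) : F[X]) := by
      rw [← C_eq_natCast]
      refine isUnit_C.mpr (IsUnit.mk0 _ fun h => hfact k (by lia) ?_)
      rw [← C_eq_natCast, h, C_0]
    exact (h2.dvd_mul_left).mp h1
  have hcop : IsCoprime G f := by
    obtain ⟨E, hE⟩ := hGf
    obtain ⟨s, hs⟩ : ∃ s, r = s + 1 := ⟨r - 1, by lia⟩
    refine ⟨-E, f ^ s, ?_⟩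
    rw [hs] at hE
    linear_combination hE
  have hdvd : G ^ (α + 1) * f ^ (r + 1 - α) ∣ V :=
    (IsCoprime.pow hcop).mul_dvd hGV hfV
  have hle := natDegree_le_of_dvd hdvd hVne
  have hwdeg : w.natDegree = q := FiniteField.X_pow_card_sub_X_natDegree_eq F hq
  have hVdeg : V.natDegree ≤ 2 * α * q := by
    refine (natDegree_sub_le _ _).trans (max_le ?_
      (natDegree_sum_le_of_forall_le (Finset.range (α + 1)) (fun k => hasseDeriv k u * w ^ k)
        fun k hk => ?_))
    · rw [natDegree_pow, hdeg, mul_comm]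
    · have hk' : k ≤ α := by simpa [Nat.lt_succ_iff] using hk
      refine (natDegree_mul_le (p := hasseDeriv k u) (q := w ^ k)).trans ?_
      rw [natDegree_pow, hwdeg]
      have h1 := natDegree_hasseDeriv_le u k
      have h2 : u.natDegree = (r + 1) * (2 * α) := by rw [hu, natDegree_pow, hdeg]
      rw [h2] at h1
      have h3 : k * 1 ≤ (r + 1) * (2 * α) := by nlinarith
      have h4 : (hasseDeriv k u).natDegree + k ≤ (r + 1) * (2 * α) := by lia
      obtain ⟨e, rfl⟩ := Nat.exists_eq_add_of_le hk'
      subst hqr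
      nlinarith
  rw [natDegree_mul (pow_ne_zero _ fun h => ?_) (pow_ne_zero _ hf.ne_zero), natDegree_pow,
    natDegree_pow, hdeg] at hle
  · obtain ⟨e, he⟩ : ∃ e, r + 1 = α + e := ⟨r + 1 - α, by lia⟩
    rw [he, add_tsub_cancel_left] at hle
    have : q + 1 = 2 * (α + e) := by lia
    nlinarith
  · rw [h, zero_dvd_iff] at hG
    rw [hG] at hdw
    simp at hdw

end Stepanov
section FiniteField

open Polynomial

variable {F : Type*} [Field F]

lemma natCast_ne_zero_of_lt {p n : ℕ} [CharP F p] (hn : 0 < n) (hnp : n < p) : (n : F) ≠ 0 := by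
  rw [Ne, CharP.cast_eq_zero_iff F p]
  exact Nat.not_dvd_of_pos_of_lt hn hnp

variable [Fintype F]

lemma X_pow_card_sub_X_dvd {P : F[X]} (h : ∀ t : F, P.eval t = 0) :
    X ^ Fintype.card F - X ∣ P := by
  have hq : 1 < Fintype.card F := Fintype.one_lt_card
  have hmon : (X ^ Fintype.card F - X : F[X]).Monic :=
    monic_X_pow_sub (by rw [degree_X]; exact_mod_cast hq)
  rw [← modByMonic_eq_zero_iff_dvd hmon]
  refine eq_zero_of_natDegree_lt_card_of_eval_eq_zero _ (f := fun t : F => t)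
    Function.injective_id (fun t => ?_) ?_
  · rw [modByMonic_eq_sub_mul_div]
    simp [h, FiniteField.pow_card]
  · have hdeg := FiniteField.X_pow_card_sub_X_natDegree_eq F hq
    have := natDegree_modByMonic_lt P hmon (by
      intro h1
      rw [h1, natDegree_one] at hdeg
      lia)
    lia

lemma X_pow_card_sub_one_dvd {P : F[X]} (h : ∀ t : F, t ≠ 0 → P.eval t = 0) :
    X ^ (Fintype.card F - 1) - 1 ∣ P := by
  have hq : 1 < Fintype.card F := Fintype.one_lt_card
  have h1 : X ^ Fintype.card F - X ∣ X * P := X_pow_card_sub_X_dvd fun t => by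
    by_cases ht : t = 0
    · simp [ht]
    · simp [h t ht]
  have h2 : (X ^ Fintype.card F - X : F[X]) = X * (X ^ (Fintype.card F - 1) - 1) := by
    rw [mul_sub, mul_pow_sub_one (by lia), mul_one]
  rwa [h2, mul_dvd_mul_iff_left X_ne_zero] at h1

lemma exists_card_eq_two_mul_add_one {p : ℕ} [CharP F p] (hp : 2 < p) :
    p.Prime ∧ p ∣ Fintype.card F ∧ ∃ r, Fintype.card F = 2 * r + 1 ∧
      ∀ x : F, x ≠ 0 → IsSquare x → x ^ r = 1 := by
  obtain ⟨k, hpp, hk⟩ := FiniteField.card F p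
  have hodd : Odd (Fintype.card F) := by
    rw [hk]
    exact (hpp.odd_of_ne_two (by lia)).pow
  obtain ⟨r, hr⟩ := hodd
  refine ⟨hpp, hk ▸ dvd_pow_self p k.ne_zero, r, hr, fun x hx hsq => ?_⟩
  have hchar : ringChar F ≠ 2 := by
    rw [ringChar.eq F p]
    lia
  have := (FiniteField.isSquare_iff hchar hx).mp hsq
  rwa [show Fintype.card F / 2 = r by lia] at this

lemma exists_quadratic_not_square_of_card_eq_five (hF : Fintype.card F = 5) [CharP F 5]
    {A B : F} (hA : A ≠ 0) (hB : B ≠ 0) (hAB : A ≠ B) :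
    ∃ t : F, ¬ ((t ^ 2 - A) * (t ^ 2 - B) ≠ 0 ∧ IsSquare ((t ^ 2 - A) * (t ^ 2 - B))) := by
  have key : ∀ A B : Fin 5, A ≠ 0 → B ≠ 0 → A ≠ B →
      ∃ t : Fin 5, ¬ ((t ^ 2 - A) * (t ^ 2 - B) ≠ 0 ∧
        ∃ r : Fin 5, (t ^ 2 - A) * (t ^ 2 - B) = r * r) := by decide
  let φ : Fin 5 ≃+* F := ZMod.ringEquiv F hF
  obtain ⟨t, ht⟩ := key (φ.symm A) (φ.symm B) (by simpa using hA) (by simpa using hB)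
    (by simpa using hAB)
  refine ⟨φ t, fun ⟨h0, s, hs⟩ => ht ?_⟩
  have hφ : (t ^ 2 - φ.symm A) * (t ^ 2 - φ.symm B) =
      φ.symm ((φ t ^ 2 - A) * (φ t ^ 2 - B)) := by simp
  refine ⟨?_, φ.symm s, ?_⟩
  · rw [hφ]
    exact (map_ne_zero_iff _ φ.symm.injective).mpr h0
  · rw [hφ, hs, map_mul]

/-- A separable polynomial `(t ^ (g + 1) - A) * (t ^ (g + 1) - B)` does not take only nonzero
square values on a finite field of characteristic exceeding `4 * g ^ 2`. -/
lemma exists_mul_not_square {p g : ℕ} [CharP F p] (hg : 1 ≤ g) (hgo : Odd g)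
    (hp : 4 * g ^ 2 < p) {A B : F} (hA : A ≠ 0) (hB : B ≠ 0) (hAB : A ≠ B) :
    ∃ t : F, ¬ ((t ^ (g + 1) - A) * (t ^ (g + 1) - B) ≠ 0 ∧
      IsSquare ((t ^ (g + 1) - A) * (t ^ (g + 1) - B))) := by
  have hgp : 2 * (g + 1) < p ∨ g = 1 := by
    rcases hg.eq_or_lt with h | h
    · exact .inr h.symm
    · left; nlinarith
  obtain ⟨hpp, hpq, r, hr, hsq⟩ := exists_card_eq_two_mul_add_one (F := F) (p := p) (by nlinarith)
  have hgp' : 2 * (g + 1) < p := by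
    rcases hgp with h | rfl
    · exact h
    · have h5 : p ≠ 4 := by rintro rfl; exact absurd hpp (by decide)
      lia
  by_contra! hall
  have hn0 : ((g + 1 : ℕ) : F) ≠ 0 := natCast_ne_zero_of_lt (p := p) (by lia) (by lia)
  set f : F[X] := (X ^ (g + 1) - C A) * (X ^ (g + 1) - C B) with hf
  have hsep : f.Separable := by
    refine (separable_X_pow_sub_C A hn0 hA).mul (separable_X_pow_sub_C B hn0 hB) ?_
    have hu : C (A - B)⁻¹ * C (A - B) = (1 : F[X]) := by
      rw [← C_mul, inv_mul_cancel₀ (sub_ne_zero.mpr hAB), C_1]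
    refine ⟨-C (A - B)⁻¹, C (A - B)⁻¹, ?_⟩
    rw [C_sub] at hu
    linear_combination hu
  have hdeg : f.natDegree = 2 * (g + 1) := by
    rw [hf, natDegree_mul (X_pow_sub_C_ne_zero (by lia) A) (X_pow_sub_C_ne_zero (by lia) B),
      natDegree_X_pow_sub_C, natDegree_X_pow_sub_C]
    ring
  have hdvd : X ^ Fintype.card F - X ∣ f ^ r - 1 := X_pow_card_sub_X_dvd fun t => by
    have h := hall t
    simp [hf, hsq _ h.1 h.2]
  have hb := stepanov_bound hpq hr Fintype.one_lt_card hpp g.succ_pos hgp' hsep hdeg dvd_rfl hdvd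
  rw [FiniteField.X_pow_card_sub_X_natDegree_eq F Fintype.one_lt_card] at hb
  have hple : p ≤ Fintype.card F := Nat.le_of_dvd Fintype.card_pos hpq
  rcases hg.eq_or_lt with h | h
  · subst h
    have h5 : Fintype.card F = 5 := by lia
    have hp5 : p = 5 := by lia
    subst hp5
    obtain ⟨t, ht⟩ := exists_quadratic_not_square_of_card_eq_five h5 hA hB hAB
    exact ht (hall t)
  · have h3 : 3 ≤ g := by
      obtain ⟨m, rfl⟩ := hgo
      lia
    nlinarith

/-- A separable polynomial `t ^ (g + 1) - B` does not take only nonzero square values on the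
nonzero elements of a finite field of characteristic exceeding `4 * g ^ 2`. -/
lemma exists_ne_zero_not_square {p g : ℕ} [CharP F p] (hg : 1 ≤ g) (hgo : Odd g)
    (hp : 4 * g ^ 2 < p) {B : F} (hB : B ≠ 0) :
    ∃ t : F, t ≠ 0 ∧ ¬ (t ^ (g + 1) - B ≠ 0 ∧ IsSquare (t ^ (g + 1) - B)) := by
  have hgp : g + 1 < p := by nlinarith
  obtain ⟨hpp, hpq, r, hr, hsq⟩ := exists_card_eq_two_mul_add_one (F := F) (p := p) (by nlinarith)
  by_contra! hall
  have hn0 : ((g + 1 : ℕ) : F) ≠ 0 := natCast_ne_zero_of_lt (p := p) (by lia) hgp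
  obtain ⟨α, hα⟩ : ∃ α, g + 1 = 2 * α := by
    obtain ⟨m, rfl⟩ := hgo
    exact ⟨m + 1, by ring⟩
  have hdvd : X ^ (Fintype.card F - 1) - 1 ∣ (X ^ (g + 1) - C B) ^ r - 1 :=
    X_pow_card_sub_one_dvd fun t ht => by
      have h := hall t ht
      simp [hsq _ h.1 h.2]
  have hG : (X ^ (Fintype.card F - 1) - 1 : F[X]) ∣ X ^ Fintype.card F - X :=
    ⟨X, by rw [sub_mul, pow_sub_one_mul (by lia), one_mul]⟩
  have hb := stepanov_bound hpq hr Fintype.one_lt_card hpp (by lia : 0 < α) (by lia)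
    (separable_X_pow_sub_C B hn0 hB) (natDegree_X_pow_sub_C.trans hα) hG hdvd
  rw [← C_1, natDegree_X_pow_sub_C] at hb
  have hple : p ≤ Fintype.card F := Nat.le_of_dvd Fintype.card_pos hpq
  obtain ⟨s, hs⟩ : ∃ s, Fintype.card F = s + 1 := ⟨2 * r, hr⟩
  rw [hs, Nat.add_sub_cancel] at hb
  have h4 : s ≤ 2 * α ^ 2 := by nlinarith
  have h5 : 4 * α ^ 2 = (g + 1) ^ 2 := by rw [hα]; ring
  nlinarith

lemma isSquare_mul_of_not_isSquare {p : ℕ} [CharP F p] (hp : 2 < p) {x y : F}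
    (hx : ¬ IsSquare x) (hy : ¬ IsSquare y) : IsSquare (x * y) := by
  have hchar : ringChar F ≠ 2 := by
    rw [ringChar.eq F p]
    lia
  classical
  have hx0 : x ≠ 0 := by rintro rfl; exact hx ⟨0, by simp⟩
  have hy0 : y ≠ 0 := by rintro rfl; exact hy ⟨0, by simp⟩
  rw [← quadraticChar_one_iff_isSquare (mul_ne_zero hx0 hy0), map_mul,
    (quadraticChar_neg_one_iff_not_isSquare).mpr hx,
    (quadraticChar_neg_one_iff_not_isSquare).mpr hy]
  norm_num

/-- The curve `e s² = (t ^ (g + 1) - A) * (t ^ (g + 1) - B)` with `A ≠ B` and `e` a nonsquare has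
a smooth point over a finite field of characteristic exceeding `4 * g ^ 2`. -/
lemma exists_smooth_point {p g : ℕ} [CharP F p] (hg : 1 ≤ g) (hgo : Odd g)
    (hp : 4 * g ^ 2 < p) {e A B : F} (he : ¬ IsSquare e) (hAB : A ≠ B) :
    ∃ t : F, ((t ^ (g + 1) - A) * (t ^ (g + 1) - B) ≠ 0 ∧
        IsSquare (e * ((t ^ (g + 1) - A) * (t ^ (g + 1) - B)))) ∨
      (A ≠ 0 ∧ t ^ (g + 1) = A) ∨ (B ≠ 0 ∧ t ^ (g + 1) = B) := by
  have hp2 : 2 < p := by nlinarith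
  have hev : Even (g + 1) := hgo.add_one
  have aux {B : F} (hB : B ≠ 0) : ∃ t : F, t ≠ 0 ∧ (t ^ (g + 1) = B ∨
      t ^ (g + 1) - B ≠ 0 ∧ IsSquare (e * (t ^ (g + 1) * (t ^ (g + 1) - B)))) := by
    obtain ⟨t, ht, h⟩ := exists_ne_zero_not_square hg hgo hp hB
    refine ⟨t, ht, ?_⟩
    by_cases h0 : t ^ (g + 1) - B = 0
    · exact .inl (sub_eq_zero.mp h0)
    · refine .inr ⟨h0, ?_⟩
      have h1 := isSquare_mul_of_not_isSquare hp2 he (fun hs => h ⟨h0, hs⟩)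
      have h2 := (hev.isSquare_pow t).mul h1
      rwa [mul_left_comm] at h2
  rcases eq_or_ne A 0 with rfl | hA
  · obtain ⟨t, ht, h | ⟨h1, h2⟩⟩ := aux hAB.symm
    · exact ⟨t, .inr (.inr ⟨hAB.symm, h⟩)⟩
    · refine ⟨t, .inl ?_⟩
      rw [sub_zero]
      exact ⟨mul_ne_zero (pow_ne_zero _ ht) h1, h2⟩
  rcases eq_or_ne B 0 with rfl | hB
  · obtain ⟨t, ht, h | ⟨h1, h2⟩⟩ := aux hA
    · exact ⟨t, .inr (.inl ⟨hA, h⟩)⟩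
    · refine ⟨t, .inl ?_⟩
      rw [sub_zero, mul_comm (_ - A)]
      exact ⟨mul_ne_zero (pow_ne_zero _ ht) h1, h2⟩
  obtain ⟨t, ht⟩ := exists_mul_not_square hg hgo hp hA hB hAB
  refine ⟨t, ?_⟩
  by_cases h0 : (t ^ (g + 1) - A) * (t ^ (g + 1) - B) = 0
  · rcases mul_eq_zero.mp h0 with h | h
    · exact .inr (.inl ⟨hA, sub_eq_zero.mp h⟩)
    · exact .inr (.inr ⟨hB, sub_eq_zero.mp h⟩)
  · exact .inl ⟨h0, isSquare_mul_of_not_isSquare hp2 he fun hs => ht ⟨h0, hs⟩⟩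

end FiniteField
section LocalField

open scoped NormedField Valued

variable {L : Type*} [NontriviallyNormedField L] [IsUltrametricDist L]

lemma exists_pow_eq_of_norm_pow_sub_lt [ProperSpace L] {n : ℕ} (hn : ‖(n : L)‖ = 1) {u t₀ : L}
    (hu : ‖u‖ = 1) (ht : ‖t₀ ^ n - u‖ < 1) : ∃ t : L, t ^ n = u := by
  have hn0 : n ≠ 0 := by rintro rfl; simp at hn
  have hpow {t : L} (h : ‖t ^ n - u‖ < 1) : ‖t‖ = 1 := by
    have h1 : ‖t ^ n‖ = 1 := by
      have := IsUltrametricDist.norm_add_eq_max_of_norm_ne_norm (x := t ^ n - u) (y := u)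
        (by rw [hu]; exact h.ne)
      rw [sub_add_cancel, hu, max_eq_right h.le] at this
      exact this
    rw [norm_pow] at h1
    exact (pow_eq_one_iff_of_nonneg (norm_nonneg t) hn0).mp h1
  obtain ⟨t, -, hmin⟩ := (isCompact_closedBall (0 : L) 1).exists_isMinOn
    ⟨t₀, by simp [hpow ht]⟩
    (by fun_prop : ContinuousOn (fun t : L => ‖t ^ n - u‖) (Metric.closedBall 0 1))
  have hmin' {y : L} (hy : ‖y‖ ≤ 1) : ‖t ^ n - u‖ ≤ ‖y ^ n - u‖ := hmin (by simpa using hy)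
  have hlt : ‖t ^ n - u‖ < 1 := (hmin' (hpow ht).le).trans_lt ht
  refine ⟨t, ?_⟩
  by_contra hne
  have hpos : 0 < ‖t ^ n - u‖ := norm_pos_iff.mpr (sub_ne_zero.mpr hne)
  have ht1 := hpow hlt
  have hn' : (n : L) ≠ 0 := by intro h; simp [h] at hn
  have ht0 : t ≠ 0 := by intro h; simp [h] at ht1
  set δ : L := -(t ^ n - u) / (n * t ^ (n - 1)) with hδ
  have hδn : ‖δ‖ = ‖t ^ n - u‖ := by
    rw [hδ, norm_div, norm_neg, norm_mul, norm_pow, hn, ht1, one_pow, mul_one, div_one]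
  have ht𝒪 : t ∈ 𝒪[L] := (Valued.integer.mem_iff).mpr ht1.le
  have hδ𝒪 : δ ∈ 𝒪[L] := (Valued.integer.mem_iff).mpr (hδn.trans_le hlt.le)
  obtain ⟨k, hk⟩ := Polynomial.powAddExpansion (⟨t, ht𝒪⟩ : 𝒪[L]) ⟨δ, hδ𝒪⟩ n
  have hk1 : ‖(k : L)‖ ≤ 1 := Valued.integer.mem_iff.mp k.2
  have hk2 : (t + δ) ^ n = t ^ n + n * t ^ (n - 1) * δ + k * δ ^ 2 := by
    simpa using congrArg (Subtype.val) hk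
  have h3 : (t + δ) ^ n - u = k * δ ^ 2 := by
    have : n * t ^ (n - 1) * δ = -(t ^ n - u) := by
      rw [hδ]; field_simp
    rw [hk2, this]; ring
  have h4 := hmin' (y := t + δ) ((IsUltrametricDist.norm_add_le_max t δ).trans
    (max_le ht1.le (hδn.trans_le hlt.le)))
  rw [h3, norm_mul, norm_pow, hδn] at h4
  nlinarith [mul_le_mul_of_nonneg_right hk1 (sq_nonneg ‖t ^ n - u‖)]

lemma residue_eq_zero_iff_norm_lt_one (x : 𝒪[L]) :
    IsLocalRing.residue 𝒪[L] x = 0 ↔ ‖(x : L)‖ < 1 := by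
  rw [IsLocalRing.residue_eq_zero_iff, IsLocalRing.mem_maximalIdeal, mem_nonunits_iff,
    Valued.integer.isUnit_iff_norm_eq_one]
  exact ⟨fun h => lt_of_le_of_ne (Valued.integer.mem_iff.mp x.2) h, fun h => h.ne⟩

lemma finite_residueField_of_properSpace [ProperSpace L] : Finite 𝓀[L] := by
  have hcomp : CompactSpace 𝒪[L] := by
    refine (isCompact_iff_compactSpace (s := (𝒪[L] : Set L))).mp ?_
    convert isCompact_closedBall (0 : L) 1
    ext x
    simp [Valued.integer.mem_iff]
  have : (Valued.v : Valuation L _).RankOne :=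
    inferInstanceAs (NormedField.valuation (K := L)).RankOne
  open Valued.integer in
  exact (compactSpace_iff_completeSpace_and_isDiscreteValuationRing_and_finite_residueField.mp
    hcomp).2.2

lemma charP_residueField {p : ℕ} (hp : p.Prime) (hpn : ‖(p : L)‖ < 1) : CharP 𝓀[L] p := by
  refine (CharP.charP_iff_prime_eq_zero hp).mpr ?_
  have h := (residue_eq_zero_iff_norm_lt_one (p : 𝒪[L])).mpr (by simpa using hpn)
  simpa using h

lemma norm_natCast_eq_one {p n : ℕ} (hp : p.Prime) (hpn : ‖(p : L)‖ < 1) (hn : 0 < n)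
    (hnp : n < p) : ‖(n : L)‖ = 1 := by
  have := charP_residueField hp hpn
  have h := mt (residue_eq_zero_iff_norm_lt_one (n : 𝒪[L])).mpr (by
    simpa using natCast_ne_zero_of_lt (F := 𝓀[L]) hn hnp)
  refine le_antisymm (IsUltrametricDist.norm_natCast_le_one L n) ?_
  simpa using h

lemma isSquare_of_norm_sq_sub_lt [ProperSpace L] (h2 : ‖(2 : L)‖ = 1) {u t : L}
    (hu : ‖u‖ = 1) (ht : ‖t ^ 2 - u‖ < 1) : IsSquare u := by
  obtain ⟨s, rfl⟩ := exists_pow_eq_of_norm_pow_sub_lt (n := 2) (by exact_mod_cast h2) hu ht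
  exact ⟨s, sq s⟩

lemma isSquare_iff_isSquare_residue [ProperSpace L] (h2 : ‖(2 : L)‖ = 1) {u : 𝒪[L]}
    (hu : ‖(u : L)‖ = 1) : IsSquare (u : L) ↔ IsSquare (IsLocalRing.residue 𝒪[L] u) := by
  constructor
  · rintro ⟨s, hs⟩
    have hs1 : ‖s‖ ≤ 1 := by
      rw [hs, norm_mul] at hu
      nlinarith [norm_nonneg s]
    refine ⟨IsLocalRing.residue 𝒪[L] ⟨s, Valued.integer.mem_iff.mpr hs1⟩, ?_⟩
    rw [← map_mul]
    congr 1
    exact Subtype.ext hs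
  · rintro ⟨s, hs⟩
    obtain ⟨s, rfl⟩ := IsLocalRing.residue_surjective s
    rw [← map_mul, ← sub_eq_zero, ← map_sub, residue_eq_zero_iff_norm_lt_one] at hs
    refine isSquare_of_norm_sq_sub_lt h2 hu (t := s) ?_
    rw [norm_sub_rev, sq]
    simpa using hs

lemma isSquare_mul_of_not_isSquare_of_norm [ProperSpace L] {p : ℕ} (hp : p.Prime) (hp2 : 2 < p)
    (hpn : ‖(p : L)‖ < 1) {x y : L} (hx1 : ‖x‖ = 1) (hy1 : ‖y‖ = 1) (hx : ¬ IsSquare x)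
    (hy : ¬ IsSquare y) : IsSquare (x * y) := by
  have h2 : ‖(2 : L)‖ = 1 := by exact_mod_cast norm_natCast_eq_one hp hpn two_pos hp2
  have := charP_residueField hp hpn
  have := finite_residueField_of_properSpace (L := L)
  have := Fintype.ofFinite 𝓀[L]
  lift x to 𝒪[L] using Valued.integer.mem_iff.mpr hx1.le
  lift y to 𝒪[L] using Valued.integer.mem_iff.mpr hy1.le
  rw [isSquare_iff_isSquare_residue h2 hx1] at hx
  rw [isSquare_iff_isSquare_residue h2 hy1] at hy
  have := isSquare_mul_of_not_isSquare hp2 hx hy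
  rw [← map_mul, ← isSquare_iff_isSquare_residue h2 (by simp [hx1, hy1])] at this
  simpa using this

/-- The curve `e s² = (t ^ (g + 1) - A) * (t ^ (g + 1) - B)` has good reduction when `A - B` is a
unit, and then it has a point over a local field of residue characteristic exceeding `4 * g ^ 2`,
also for a unit `e` that is not a square. -/
lemma exists_point_of_norm_sub_eq_one [ProperSpace L] {p g : ℕ} (hp : p.Prime)
    (hpn : ‖(p : L)‖ < 1) (hg : 1 ≤ g) (hgo : Odd g) (hpg : 4 * g ^ 2 < p) {e A B : L}
    (he : ‖e‖ = 1) (hesq : ¬ IsSquare e) (hA : ‖A‖ ≤ 1) (hB : ‖B‖ ≤ 1) (hAB : ‖A - B‖ = 1) :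
    ∃ s t : L, e * s ^ 2 = (t ^ (g + 1) - A) * (t ^ (g + 1) - B) := by
  have h2 : ‖(2 : L)‖ = 1 := by
    exact_mod_cast norm_natCast_eq_one hp hpn two_pos (by nlinarith)
  have hn : ‖((g + 1 : ℕ) : L)‖ = 1 := norm_natCast_eq_one hp hpn g.succ_pos (by nlinarith)
  have := charP_residueField hp hpn
  have := finite_residueField_of_properSpace (L := L)
  have := Fintype.ofFinite 𝓀[L]
  lift e to 𝒪[L] using Valued.integer.mem_iff.mpr he.le
  lift A to 𝒪[L] using Valued.integer.mem_iff.mpr hA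
  lift B to 𝒪[L] using Valued.integer.mem_iff.mpr hB
  have root {A : 𝒪[L]} {t : 𝒪[L]} (hA : IsLocalRing.residue 𝒪[L] A ≠ 0)
      (ht : IsLocalRing.residue 𝒪[L] t ^ (g + 1) = IsLocalRing.residue 𝒪[L] A) :
      ∃ t : L, t ^ (g + 1) = A := by
    rw [← map_pow, ← sub_eq_zero, ← map_sub, residue_eq_zero_iff_norm_lt_one] at ht
    rw [Ne, residue_eq_zero_iff_norm_lt_one, not_lt] at hA
    exact exists_pow_eq_of_norm_pow_sub_lt hn
      (le_antisymm (Valued.integer.mem_iff.mp A.2) hA) (t₀ := t) (by simpa using ht)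
  have hAB' : IsLocalRing.residue 𝒪[L] A ≠ IsLocalRing.residue 𝒪[L] B := by
    rw [Ne, ← sub_eq_zero, ← map_sub, residue_eq_zero_iff_norm_lt_one]
    simp [hAB]
  obtain ⟨t, ht⟩ := exists_smooth_point hg hgo hpg
    (mt (isSquare_iff_isSquare_residue h2 he).mpr hesq) hAB'
  obtain ⟨t, rfl⟩ := IsLocalRing.residue_surjective t
  rcases ht with ⟨h0, hsq⟩ | ⟨h0, h1⟩ | ⟨h0, h1⟩
  · have hu : ‖(((t ^ (g + 1) - A) * (t ^ (g + 1) - B) : 𝒪[L]) : L)‖ = 1 := by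
      refine le_antisymm (Valued.integer.mem_iff.mp (Subtype.prop _)) (not_lt.mp ?_)
      rw [← residue_eq_zero_iff_norm_lt_one]
      simpa using h0
    have hsq' : IsSquare ((e * ((t ^ (g + 1) - A) * (t ^ (g + 1) - B)) : 𝒪[L]) : L) := by
      rw [isSquare_iff_isSquare_residue h2]
      · simpa using hsq
      · rw [MulMemClass.coe_mul, norm_mul, hu, he, one_mul]
    obtain ⟨w, hw⟩ := hsq'
    have he0 : (e : L) ≠ 0 := by intro h; simp [h] at he
    refine ⟨w / e, t, ?_⟩
    push_cast at hw
    field_simp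
    rw [sq, ← hw, mul_assoc]
  · obtain ⟨s, hs⟩ := root h0 h1
    exact ⟨0, s, by simp [hs]⟩
  · obtain ⟨s, hs⟩ := root h0 h1
    exact ⟨0, s, by simp [hs]⟩

end LocalField
section Fibers

/-- The affine chart `a s² = b (t ^ (g + 1) - A) (t ^ (g + 1) - B)` has an `L`-point. -/
def HasPoint {L : Type*} [Field L] (g : ℕ) (a b A B : L) : Prop :=
  ∃ s t : L, a * s ^ 2 = b * ((t ^ (g + 1) - A) * (t ^ (g + 1) - B))

section Field

variable {L : Type*} [Field L] {g h : ℕ} {a b c d A B x z l : L}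

lemma HasPoint.smul (hp : HasPoint g a b A B) (l : L) :
    HasPoint g a b (l ^ (g + 1) * A) (l ^ (g + 1) * B) := by
  obtain ⟨s, t, hst⟩ := hp
  refine ⟨l ^ (g + 1) * s, l * t, ?_⟩
  rw [mul_pow l t]
  linear_combination (l ^ (g + 1)) ^ 2 * hst

lemma hasPoint_of_pow_eq {t : L} (ht : t ^ (g + 1) = A) : HasPoint g a b A B :=
  ⟨0, t, by simp [ht]⟩

/-- The homogeneous form of `D_θ`, at `θ = x / z`. -/
def homD (a b : L) (h g : ℕ) (x z : L) : L :=
  b ^ (2 * h + 1) * (a ^ (2 * h + 1) * x ^ (g + 1)) - z ^ (g + 1)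

/-- The homogeneous form of `A_θ` and `B_θ`, with `e = b c² d` or `e = b c² d + 2 c`. -/
def homAB (a b e : L) (h g : ℕ) (x z : L) : L :=
  a * (a ^ (2 * h + 1) * x ^ (g + 1)) ^ 2 + e * homD a b h g x z ^ 2

/-- The fiber over `(x : z)` has a point in its first affine chart. -/
def HasFiberPoint (h g : ℕ) (a b c d x z : L) : Prop :=
  HasPoint g a b (homAB a b (b * c ^ 2 * d) h g x z) (homAB a b (b * c ^ 2 * d + 2 * c) h g x z)

lemma homAB_sub_homAB (e f : L) :
    homAB a b e h g x z - homAB a b f h g x z = (e - f) * homD a b h g x z ^ 2 := by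
  simp only [homAB]
  ring

lemma homAB_mul_mul (e l : L) :
    homAB a b e h g (l * x) (l * z) = (l ^ 2) ^ (g + 1) * homAB a b e h g x z := by
  simp only [homAB, homD]
  ring

lemma HasFiberPoint.mul_mul (hp : HasFiberPoint h g a b c d x z) (l : L) :
    HasFiberPoint h g a b c d (l * x) (l * z) := by
  simp only [HasFiberPoint, homAB_mul_mul]
  exact hp.smul _

lemma xAllFibers_of_hasFiberPoint
    (hp : ∀ x z : L, (x ≠ 0 ∨ z ≠ 0) → HasFiberPoint h g a b c d x z) :
    XAllFibers h g a b c d := by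
  refine ⟨fun θ => .inl ?_, .inl ?_⟩
  · have key (e : L) : homAB a b e h g θ 1 =
        a ^ (4 * h + 3) * θ ^ (2 * g + 2) + e * Dval a b h g θ ^ 2 := by
      simp only [homAB, homD, Dval]
      ring
    have := hp θ 1 (.inr one_ne_zero)
    rwa [HasFiberPoint, key, key] at this
  · have key (e : L) : homAB a b e h g 1 0 = a ^ (4 * h + 3) + e * Dinf a b h ^ 2 := by
      simp only [homAB, homD, Dinf]
      ring
    have := hp 1 0 (.inl one_ne_zero)
    rwa [HasFiberPoint, key, key] at this

lemma xAllFibers_of_isSquare_mul (ha : a ≠ 0) (hab : IsSquare (a * b)) :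
    XAllFibers h g a b c d := by
  obtain ⟨r, hr⟩ := hab
  have key (A B : L) : XPoint g a b A B := by
    refine .inr ⟨r / a, 0, ?_⟩
    field_simp
    simp
    linear_combination -hr
  exact ⟨fun θ => key _ _, key _ _⟩

lemma isSquare_of_isSquare_pow_mul_sq {w y : L} {N : ℕ} (hN : Odd N) (hw : w ≠ 0) (hy : y ≠ 0)
    (hsq : IsSquare (w ^ N * y ^ 2)) : IsSquare w := by
  obtain ⟨j, rfl⟩ := hN
  obtain ⟨r, hr⟩ := hsq
  refine ⟨r / (w ^ j * y), ?_⟩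
  field_simp
  linear_combination hr

end Field

section Local

open scoped NormedField Valued

variable {L : Type*} [NontriviallyNormedField L] [IsUltrametricDist L]

lemma norm_add_lt_of_both_lt {x y : L} {r : ℝ} (hx : ‖x‖ < r) (hy : ‖y‖ < r) : ‖x + y‖ < r :=
  (IsUltrametricDist.norm_add_le_max x y).trans_lt (max_lt hx hy)

lemma norm_add_le_of_both_le {x y : L} {r : ℝ} (hx : ‖x‖ ≤ r) (hy : ‖y‖ ≤ r) : ‖x + y‖ ≤ r :=
  (IsUltrametricDist.norm_add_le_max x y).trans (max_le hx hy)

lemma norm_sub_lt_of_both_lt {x y : L} {r : ℝ} (hx : ‖x‖ < r) (hy : ‖y‖ < r) : ‖x - y‖ < r := by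
  rw [sub_eq_add_neg]
  exact norm_add_lt_of_both_lt hx (by rwa [norm_neg])

lemma norm_sub_le_of_both_le {x y : L} {r : ℝ} (hx : ‖x‖ ≤ r) (hy : ‖y‖ ≤ r) : ‖x - y‖ ≤ r := by
  rw [sub_eq_add_neg]
  exact norm_add_le_of_both_le hx (by rwa [norm_neg])

lemma norm_eq_of_norm_sub_lt {x y : L} (hxy : ‖x - y‖ < ‖y‖) : ‖x‖ = ‖y‖ := by
  have := IsUltrametricDist.norm_add_eq_max_of_norm_ne_norm (x := x - y) (y := y) hxy.ne
  rwa [sub_add_cancel, max_eq_right hxy.le] at this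

lemma exists_pow_eq_of_norm_sub_pow_lt [ProperSpace L] {n : ℕ} (hn : ‖(n : L)‖ = 1) {A v : L}
    (hA : ‖A - v ^ n‖ < ‖v ^ n‖) : ∃ t : L, t ^ n = A := by
  have hv0 : v ^ n ≠ 0 := norm_pos_iff.mp ((norm_nonneg _).trans_lt hA)
  have hv1 : ‖v ^ n‖ ≠ 0 := norm_ne_zero_iff.mpr hv0
  obtain ⟨t, ht⟩ := exists_pow_eq_of_norm_pow_sub_lt hn (u := A / v ^ n) (t₀ := 1)
    (by rw [norm_div, norm_eq_of_norm_sub_lt hA, div_self hv1])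
    (by
      rw [one_pow, norm_sub_rev, div_sub_one hv0, norm_div]
      exact (div_lt_one (norm_pos_iff.mpr hv0)).mpr hA)
  exact ⟨t * v, by rw [mul_pow, ht, div_mul_cancel₀ _ hv0]⟩

lemma isSquare_of_norm_sub_sq_lt [ProperSpace L] (h2 : ‖(2 : L)‖ = 1) {A v : L}
    (hA : ‖A - v ^ 2‖ < ‖v ^ 2‖) : IsSquare A := by
  obtain ⟨t, rfl⟩ := exists_pow_eq_of_norm_sub_pow_lt (n := 2) (by exact_mod_cast h2) hA
  exact ⟨t, sq t⟩

variable [ProperSpace L] {p g h : ℕ} {a b c d x z : L}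

omit [ProperSpace L] in
lemma norm_homAB_le_one {e : L} (ha : ‖a‖ ≤ 1) (he : ‖e‖ ≤ 1)
    (hx : ‖a ^ (2 * h + 1) * x ^ (g + 1)‖ ≤ 1) (hD : ‖homD a b h g x z‖ ≤ 1) :
    ‖homAB a b e h g x z‖ ≤ 1 := by
  refine norm_add_le_of_both_le ?_ ?_ <;> rw [norm_mul, norm_pow]
  · exact mul_le_one₀ ha (by positivity) (pow_le_one₀ (norm_nonneg _) hx)
  · exact mul_le_one₀ he (by positivity) (pow_le_one₀ (norm_nonneg _) hD)

/-- The fiber over a point at which `D` and the relevant coefficients are integral, `D`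
and the discriminant are units, and where the leading coefficient is a nonsquare unit. -/
lemma exists_point_of_norm_homD_eq_one (hp : p.Prime) (hpn : ‖(p : L)‖ < 1) (hg : 1 ≤ g)
    (hgo : Odd g) (hpg : 4 * g ^ 2 < p) {e : L} (he : ‖e‖ = 1) (hesq : ¬ IsSquare e)
    (ha : ‖a‖ ≤ 1) (hb : ‖b‖ ≤ 1) (hc : ‖c‖ = 1) (hd : ‖d‖ ≤ 1)
    (hx : ‖a ^ (2 * h + 1) * x ^ (g + 1)‖ ≤ 1) (hD : ‖homD a b h g x z‖ = 1) :
    ∃ s t : L, e * s ^ 2 = (t ^ (g + 1) - homAB a b (b * c ^ 2 * d) h g x z) *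
      (t ^ (g + 1) - homAB a b (b * c ^ 2 * d + 2 * c) h g x z) := by
  have h2 : ‖(2 : L)‖ = 1 := by
    exact_mod_cast norm_natCast_eq_one hp hpn two_pos (by nlinarith)
  have he1 : ‖b * c ^ 2 * d‖ ≤ 1 := by
    simpa [hc] using mul_le_one₀ hb (norm_nonneg d) hd
  have he2 : ‖b * c ^ 2 * d + 2 * c‖ ≤ 1 := norm_add_le_of_both_le he1 (by simp [h2, hc])
  refine exists_point_of_norm_sub_eq_one hp hpn hg hgo hpg he hesq
    (norm_homAB_le_one ha he1 hx hD.le) (norm_homAB_le_one ha he2 hx hD.le) ?_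
  rw [homAB_sub_homAB]
  simp [h2, hc, hD]

lemma hasFiberPoint_of_norm_eq_one (hp : p.Prime) (hpn : ‖(p : L)‖ < 1) (hg : 1 ≤ g)
    (hgo : Odd g) (hpg : 4 * g ^ 2 < p) (hab : ¬ IsSquare (a * b))
    (ha : ‖a‖ = 1) (hb : ‖b‖ = 1) (hc : ‖c‖ = 1) (hd : ‖d‖ ≤ 1) (hxz : x ≠ 0 ∨ z ≠ 0) :
    HasFiberPoint h g a b c d x z := by
  wlog hn : ‖x‖ ≤ 1 ∧ ‖z‖ ≤ 1 ∧ (‖x‖ = 1 ∨ ‖z‖ = 1) generalizing x z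
  · obtain ⟨l, hl, hl'⟩ : ∃ l : L, l ≠ 0 ∧ ‖l‖ = max ‖x‖ ‖z‖ := by
      rcases le_total ‖x‖ ‖z‖ with hle | hle
      · refine ⟨z, ?_, (max_eq_right hle).symm⟩
        rintro rfl
        simp at hle hxz
        exact hxz hle
      · refine ⟨x, ?_, (max_eq_left hle).symm⟩
        rintro rfl
        simp at hle hxz
        exact hxz hle
    have hlpos : 0 < ‖l‖ := norm_pos_iff.mpr hl
    have := (this (x := x / l) (z := z / l) (by simpa [hl] using hxz) (by
      rw [norm_div, norm_div, div_le_one hlpos, div_le_one hlpos, div_eq_one_iff_eq hlpos.ne',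
        div_eq_one_iff_eq hlpos.ne', hl']
      refine ⟨le_max_left _ _, le_max_right _ _, ?_⟩
      rcases max_choice ‖x‖ ‖z‖ with h | h
      · exact .inl h.symm
      · exact .inr h.symm)).mul_mul l
    rwa [mul_div_cancel₀ _ hl, mul_div_cancel₀ _ hl] at this
  obtain ⟨hx, hz, hxz⟩ := hn
  have h2 : ‖(2 : L)‖ = 1 := by
    exact_mod_cast norm_natCast_eq_one hp hpn two_pos (by nlinarith)
  have ha0 : a ≠ 0 := norm_ne_zero_iff.mp (by simp [ha])
  have hb0 : b ≠ 0 := norm_ne_zero_iff.mp (by simp [hb])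
  have hX : ‖b ^ (2 * h + 1) * (a ^ (2 * h + 1) * x ^ (g + 1))‖ = ‖x‖ ^ (g + 1) := by
    simp [ha, hb]
  have hD1 : ‖homD a b h g x z‖ ≤ 1 := norm_sub_le_of_both_le
    (hX.trans_le (pow_le_one₀ (norm_nonneg _) hx)) (by
      rw [norm_pow]
      exact pow_le_one₀ (norm_nonneg _) hz)
  have hD : ‖homD a b h g x z‖ = 1 := by
    refine le_antisymm hD1 (not_lt.mp fun hlt => hab ?_)
    have hx1 : ‖x‖ = 1 := by
      by_contra hne
      have hz1 := hxz.resolve_left hne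
      have h1 : ‖z ^ (g + 1)‖ < 1 := by
        rw [← sub_sub_cancel (b ^ (2 * h + 1) * (a ^ (2 * h + 1) * x ^ (g + 1))) (z ^ (g + 1))]
        refine norm_sub_lt_of_both_lt ?_ hlt
        rw [hX]
        exact pow_lt_one₀ (norm_nonneg _) (lt_of_le_of_ne hx hne) g.succ_ne_zero
      simp [hz1] at h1
    obtain ⟨m, hm⟩ := hgo.add_one
    have hx0 : x ≠ 0 := norm_ne_zero_iff.mp (by simp [hx1])
    refine isSquare_of_isSquare_pow_mul_sq (N := 2 * h + 1) ⟨h, rfl⟩ (mul_ne_zero ha0 hb0)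
      (pow_ne_zero m hx0) (isSquare_of_norm_sq_sub_lt h2 (t := z ^ m) (by simp [ha, hb, hx1]) ?_)
    have hDeq : (a * b) ^ (2 * h + 1) * (x ^ m) ^ 2 - (z ^ m) ^ 2 = homD a b h g x z := by
      simp only [homD, hm]
      ring
    rwa [norm_sub_rev, hDeq]
  obtain ⟨s, t, hst⟩ := exists_point_of_norm_homD_eq_one hp hpn hg hgo hpg (e := a * b)
    (by simp [ha, hb]) hab ha.le hb.le hc hd (by simpa [ha] using pow_le_one₀ (norm_nonneg _) hx) hD
  exact ⟨b * s, t, by rw [← hst]; ring⟩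

lemma hasFiberPoint_of_norm_a_lt_one (hp : p.Prime) (hpn : ‖(p : L)‖ < 1) (hg : 1 ≤ g)
    (hgo : Odd g) (hpg : 4 * g ^ 2 < p) (hdvd : g + 1 ∣ 4 * h + 2) (hasq : ¬ IsSquare a)
    (hbsq : IsSquare b) (ha : ‖a‖ < 1) (hb : ‖b‖ = 1) (hc : ‖c‖ = 1) (hd : ‖d‖ ≤ 1)
    (hbcd : ‖b * c ^ 2 * d - 1‖ < 1) (hxz : x ≠ 0 ∨ z ≠ 0) :
    HasFiberPoint h g a b c d x z := by
  have h2 : ‖(2 : L)‖ = 1 := by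
    exact_mod_cast norm_natCast_eq_one hp hpn two_pos (by nlinarith)
  have hn : ‖((g + 1 : ℕ) : L)‖ = 1 := norm_natCast_eq_one hp hpn g.succ_pos (by nlinarith)
  have ha0 : a ≠ 0 := by rintro rfl; exact hasq (.zero)
  obtain ⟨k, hk⟩ := hdvd
  set P := a ^ (2 * h + 1) * x ^ (g + 1) with hPdef
  have hA : homAB a b (b * c ^ 2 * d) h g x z =
      a * P ^ 2 + b * c ^ 2 * d * (b ^ (2 * h + 1) * P - z ^ (g + 1)) ^ 2 := rfl
  have hbP : ‖b ^ (2 * h + 1) * P‖ = ‖P‖ := by simp [hb]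
  rcases lt_trichotomy ‖P‖ ‖z ^ (g + 1)‖ with hlt | heq | hlt
  · have hDn : ‖b ^ (2 * h + 1) * P - z ^ (g + 1)‖ ≤ ‖z ^ (g + 1)‖ :=
      norm_sub_le_of_both_le (hbP.trans_le hlt.le) le_rfl
    have hpos : 0 < ‖z ^ (g + 1)‖ := (norm_nonneg _).trans_lt hlt
    obtain ⟨t, ht⟩ := exists_pow_eq_of_norm_sub_pow_lt hn (v := z ^ 2)
      (A := homAB a b (b * c ^ 2 * d) h g x z) (by
        rw [hA, pow_right_comm z 2]
        have : a * P ^ 2 + b * c ^ 2 * d * (b ^ (2 * h + 1) * P - z ^ (g + 1)) ^ 2 -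
            (z ^ (g + 1)) ^ 2 = a * P ^ 2 + (b * c ^ 2 * d - 1) *
              (b ^ (2 * h + 1) * P - z ^ (g + 1)) ^ 2 +
              b ^ (2 * h + 1) * P * (b ^ (2 * h + 1) * P - z ^ (g + 1) - z ^ (g + 1)) := by ring
        rw [this, norm_pow]
        refine norm_add_lt_of_both_lt (norm_add_lt_of_both_lt ?_ ?_) ?_
        · rw [norm_mul, norm_pow]
          calc ‖a‖ * ‖P‖ ^ 2 ≤ 1 * ‖P‖ ^ 2 := by gcongr
            _ < ‖z ^ (g + 1)‖ ^ 2 := by rw [one_mul]; gcongr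
        · rw [norm_mul, norm_pow]
          calc _ ≤ ‖b * c ^ 2 * d - 1‖ * ‖z ^ (g + 1)‖ ^ 2 := by gcongr
            _ < 1 * ‖z ^ (g + 1)‖ ^ 2 := by gcongr
            _ = _ := one_mul _
        · rw [norm_mul, hbP, sq]
          exact mul_lt_mul_of_lt_of_le_of_nonneg_of_pos hlt (norm_sub_le_of_both_le hDn le_rfl)
            (norm_nonneg _) hpos)
    exact hasPoint_of_pow_eq ht
  · have hz0 : z ≠ 0 := by
      rintro rfl
      have h0 : P = 0 := by simpa using heq
      simp [hPdef, ha0] at h0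
      simp [h0] at hxz
    set M := a ^ (2 * h + 1) * (x / z) ^ (g + 1) with hMdef
    have hMP : M = P / z ^ (g + 1) := by rw [hMdef, hPdef, div_pow, mul_div_assoc]
    have hM1 : ‖M‖ = 1 := by
      rw [hMP, norm_div, heq, div_self (norm_ne_zero_iff.mpr (pow_ne_zero _ hz0))]
    have hx0 : x / z ≠ 0 := by
      intro h0
      simp [hMdef, h0] at hM1
    obtain ⟨m, hm⟩ := hgo.add_one
    obtain ⟨β, rfl⟩ := hbsq
    have hβ : ‖β‖ = 1 := by
      rw [norm_mul] at hb
      nlinarith [norm_nonneg β]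
    have hβ0 : β ≠ 0 := norm_ne_zero_iff.mp (by simp [hβ])
    have hMsq : ¬ IsSquare M := fun hsq => hasq
      (isSquare_of_isSquare_pow_mul_sq (N := 2 * h + 1) ⟨h, rfl⟩ ha0 (pow_ne_zero m hx0) (by
        rwa [← pow_mul, mul_two, ← hm]))
    have hD1 : ‖homD a (β * β) h g (x / z) 1‖ ≤ 1 := by
      refine norm_sub_le_of_both_le ?_ (by simp)
      rw [← hMdef]
      simp [hβ, hM1]
    have hD : ‖homD a (β * β) h g (x / z) 1‖ = 1 := by
      refine le_antisymm hD1 (not_lt.mp fun hlt => hMsq ?_)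
      have h1 : IsSquare ((β * β) ^ (2 * h + 1) * M) :=
        isSquare_of_norm_sub_sq_lt h2 (v := 1) (by simpa [homD] using hlt)
      have h3 := h1.div (IsSquare.mul_self (β ^ (2 * h + 1)))
      rwa [← mul_pow, mul_div_cancel_left₀ _ (by positivity)] at h3
    obtain ⟨s, t, hst⟩ := exists_point_of_norm_homD_eq_one hp hpn hg hgo hpg hM1 hMsq ha.le hb.le
      hc hd hM1.le hD
    have hpt : HasFiberPoint h g a (β * β) c d (x / z) 1 := by
      refine ⟨β * (a ^ h * (x / z) ^ m) * s, t, ?_⟩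
      rw [← hst, hMdef, hm]
      ring
    have := hpt.mul_mul z
    rwa [mul_one, mul_div_cancel₀ _ hz0] at this
  · have hDn : ‖b ^ (2 * h + 1) * P - z ^ (g + 1)‖ ≤ ‖P‖ :=
      norm_sub_le_of_both_le hbP.le hlt.le
    have hpos : 0 < ‖P‖ := (norm_nonneg _).trans_lt hlt
    have hv : (b ^ k * a ^ k * x ^ 2) ^ (g + 1) = (b ^ (2 * h + 1) * P) ^ 2 := by
      rw [mul_pow, mul_pow, ← pow_mul, ← pow_mul, mul_comm k, ← hk, hPdef]
      ring
    obtain ⟨t, ht⟩ := exists_pow_eq_of_norm_sub_pow_lt hn (v := b ^ k * a ^ k * x ^ 2)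
      (A := homAB a b (b * c ^ 2 * d) h g x z) (by
        rw [hA, hv]
        have : a * P ^ 2 + b * c ^ 2 * d * (b ^ (2 * h + 1) * P - z ^ (g + 1)) ^ 2 -
            (b ^ (2 * h + 1) * P) ^ 2 = a * P ^ 2 + (b * c ^ 2 * d - 1) *
              (b ^ (2 * h + 1) * P - z ^ (g + 1)) ^ 2 -
              z ^ (g + 1) * (b ^ (2 * h + 1) * P - z ^ (g + 1) + b ^ (2 * h + 1) * P) := by ring
        rw [this, norm_pow, hbP]
        refine norm_sub_lt_of_both_lt (norm_add_lt_of_both_lt ?_ ?_) ?_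
        · rw [norm_mul, norm_pow]
          exact mul_lt_of_lt_one_left (by positivity) ha
        · rw [norm_mul, norm_pow]
          calc _ ≤ ‖b * c ^ 2 * d - 1‖ * ‖P‖ ^ 2 := by gcongr
            _ < 1 * ‖P‖ ^ 2 := by gcongr
            _ = _ := one_mul _
        · rw [norm_mul, sq]
          exact mul_lt_mul_of_lt_of_le_of_nonneg_of_pos hlt (norm_add_le_of_both_le hDn hbP.le)
            (norm_nonneg _) hpos)
    exact hasPoint_of_pow_eq ht

lemma hasFiberPoint_of_norm_b_mul_lt (hn : ‖((g + 1 : ℕ) : L)‖ = 1) (hdvd : g + 1 ∣ 4 * h + 2)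
    (ha : ‖a - 1‖ < 1) (hc : ‖c‖ = 1) (hd : ‖d‖ = 1)
    (hlt : ‖b * homD a b h g x z ^ 2‖ < ‖(a ^ (2 * h + 1) * x ^ (g + 1)) ^ 2‖) :
    HasFiberPoint h g a b c d x z := by
  obtain ⟨k, hk⟩ := hdvd
  have hv : (a ^ k * x ^ 2) ^ (g + 1) = (a ^ (2 * h + 1) * x ^ (g + 1)) ^ 2 := by
    rw [mul_pow, ← pow_mul, mul_comm k, ← hk]
    ring
  obtain ⟨t, ht⟩ := exists_pow_eq_of_norm_sub_pow_lt hn (v := a ^ k * x ^ 2)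
    (A := homAB a b (b * c ^ 2 * d) h g x z) (by
      rw [hv]
      have : homAB a b (b * c ^ 2 * d) h g x z - (a ^ (2 * h + 1) * x ^ (g + 1)) ^ 2 =
          (a - 1) * (a ^ (2 * h + 1) * x ^ (g + 1)) ^ 2 +
            c ^ 2 * d * (b * homD a b h g x z ^ 2) := by
        simp only [homAB]
        ring
      rw [this]
      refine norm_add_lt_of_both_lt ?_ (by simpa [hc, hd] using hlt)
      rw [norm_mul]
      exact mul_lt_of_lt_one_left ((norm_nonneg _).trans_lt hlt) ha)
  exact hasPoint_of_pow_eq ht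

lemma hasFiberPoint_of_le_norm_b_mul (hp : p.Prime) (hpn : ‖(p : L)‖ < 1) (hg : 1 ≤ g)
    (hgo : Odd g) (hpg : 4 * g ^ 2 < p) (hbsq : ¬ IsSquare b) (hasq : IsSquare a)
    (h2sq : IsSquare (2 : L)) (hcd : IsSquare (c * d)) (hb : ‖b‖ < 1) (ha : ‖a‖ = 1)
    (hc : ‖c‖ = 1) (hd : ‖d‖ = 1)
    (hle : ‖(a ^ (2 * h + 1) * x ^ (g + 1)) ^ 2‖ ≤ ‖b * homD a b h g x 1 ^ 2‖) :
    HasFiberPoint h g a b c d x 1 := by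
  have h2 : ‖(2 : L)‖ = 1 := by
    exact_mod_cast norm_natCast_eq_one hp hpn two_pos (by nlinarith)
  have hb0 : b ≠ 0 := by rintro rfl; exact hbsq (.zero)
  have hbpos : 0 < ‖b‖ := norm_pos_iff.mpr hb0
  set P := a ^ (2 * h + 1) * x ^ (g + 1) with hPdef
  set D := homD a b h g x 1 with hDdef
  have hDP : D = b ^ (2 * h + 1) * P - 1 := by rw [hDdef, homD, one_pow]
  have hbP : ‖b ^ (2 * h + 1) * P‖ ≤ ‖P‖ := by
    rw [norm_mul, norm_pow]
    exact mul_le_of_le_one_left (norm_nonneg _) (pow_le_one₀ (norm_nonneg _) hb.le)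
  have hP1 : ‖P‖ < 1 := by
    by_contra! h1
    have hD : ‖D‖ ≤ ‖P‖ := by
      rw [hDP]
      exact norm_sub_le_of_both_le hbP (by simpa using h1)
    have h3 : ‖b * D ^ 2‖ < ‖P ^ 2‖ := by
      rw [norm_mul, norm_pow, norm_pow]
      calc ‖b‖ * ‖D‖ ^ 2 ≤ ‖b‖ * ‖P‖ ^ 2 := by gcongr
        _ < 1 * ‖P‖ ^ 2 := by gcongr
        _ = _ := one_mul _
    exact h3.not_ge hle
  have hD1 : ‖D + 1‖ < 1 := by
    rw [hDP, sub_add_cancel]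
    exact hbP.trans_lt hP1
  have hD : ‖D‖ = 1 := by
    rw [norm_eq_of_norm_sub_lt (y := -1) (by simpa using hD1), norm_neg, norm_one]
  have hDsq : ‖D ^ 2 - 1‖ < 1 := by
    rw [show D ^ 2 - 1 = (D + 1) * (D - 1) by ring, norm_mul]
    exact mul_lt_one_of_nonneg_of_lt_one_left (norm_nonneg _) hD1
      (norm_sub_le_of_both_le hD.le norm_one.le)
  rw [norm_mul, norm_pow D, hD, one_pow, mul_one] at hle
  have ha0 : a ≠ 0 := norm_ne_zero_iff.mp (by simp [ha])
  obtain ⟨α, rfl⟩ := hasq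
  have hα0 : α ≠ 0 := by simpa using ha0
  rcases hle.eq_or_lt with heq | hlt
  · have hP0 : P ≠ 0 := by
      rintro h0
      rw [h0, zero_pow two_ne_zero, norm_zero] at heq
      exact hbpos.ne heq
    obtain ⟨s, t, hst⟩ := exists_point_of_norm_homD_eq_one hp hpn hg hgo hpg (e := b / P ^ 2)
      (a := α * α) (b := b) (c := c) (d := d) (x := x) (z := 1) (h := h)
      (by rw [norm_div, heq, div_self hbpos.ne'])
      (fun hsq => hbsq (by
        have := hsq.mul (IsSquare.sq P)
        rwa [div_mul_cancel₀ _ (pow_ne_zero 2 hP0)] at this))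
      ha.le hb.le hc hd.le hP1.le hD
    refine ⟨b * s / (P * α), t, ?_⟩
    rw [← hst]
    field_simp
  · obtain ⟨δ, hδ⟩ := h2sq
    obtain ⟨γ, hγ⟩ := hcd
    have hbc : ‖b * c ^ 2 * d‖ = ‖b‖ := by simp [hc, hd]
    have hε₁ : ‖homAB (α * α) b (b * c ^ 2 * d) h g x 1 - b * c ^ 2 * d‖ < ‖b‖ := by
      have : homAB (α * α) b (b * c ^ 2 * d) h g x 1 - b * c ^ 2 * d =
          α * α * P ^ 2 + b * c ^ 2 * d * (D ^ 2 - 1) := by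
        rw [homAB, ← hDdef]
        ring
      rw [this]
      refine norm_add_lt_of_both_lt ?_ ?_
      · rwa [norm_mul, ha, one_mul]
      · rw [norm_mul, hbc]
        exact mul_lt_of_lt_one_right hbpos hDsq
    have hε₂ : ‖homAB (α * α) b (b * c ^ 2 * d + 2 * c) h g x 1 - 2 * c‖ < 1 := by
      have : homAB (α * α) b (b * c ^ 2 * d + 2 * c) h g x 1 - 2 * c =
          α * α * P ^ 2 + b * c ^ 2 * d * D ^ 2 + 2 * c * (D ^ 2 - 1) := by
        rw [homAB, ← hDdef]
        ring
      rw [this]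
      refine norm_add_lt_of_both_lt (norm_add_lt_of_both_lt ?_ ?_) ?_
      · rw [norm_mul, ha, one_mul]
        exact hlt.trans hb
      · rwa [norm_mul, hbc, norm_pow, hD, one_pow, mul_one]
      · rwa [norm_mul, norm_mul, h2, hc, one_mul, one_mul]
    set A := homAB (α * α) b (b * c ^ 2 * d) h g x 1 with hAdef
    set B := homAB (α * α) b (b * c ^ 2 * d + 2 * c) h g x 1 with hBdef
    have hB : ‖B‖ = 1 := by
      rw [norm_eq_of_norm_sub_lt (y := 2 * c) (by simpa [h2, hc] using hε₂)]
      simp [h2, hc]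
    have hv : (b * c * γ * δ) ^ 2 = b * (b * c ^ 2 * d * (2 * c)) := by
      linear_combination (-b ^ 2 * c ^ 2) * (γ ^ 2 * hδ + 2 * hγ)
    obtain ⟨w, hw⟩ : IsSquare (b * (A * B)) := by
      refine isSquare_of_norm_sub_sq_lt h2 (v := b * c * γ * δ) ?_
      rw [hv, ← mul_sub, norm_mul, norm_mul b]
      refine mul_lt_mul_of_pos_left ?_ hbpos
      have : A * B - b * c ^ 2 * d * (2 * c) =
          (A - b * c ^ 2 * d) * B + b * c ^ 2 * d * (B - 2 * c) := by ring
      rw [this, norm_mul, hbc, norm_mul, h2, hc, one_mul, mul_one]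
      refine norm_add_lt_of_both_lt ?_ ?_
      · rwa [norm_mul, hB, mul_one]
      · rw [norm_mul, hbc]
        exact mul_lt_of_lt_one_right hbpos hε₂
    refine ⟨w / α, 0, ?_⟩
    rw [zero_pow g.succ_ne_zero, zero_sub, zero_sub, neg_mul_neg, hw]
    field_simp

lemma hasFiberPoint_of_norm_b_lt_one (hp : p.Prime) (hpn : ‖(p : L)‖ < 1) (hg : 1 ≤ g)
    (hgo : Odd g) (hpg : 4 * g ^ 2 < p) (hdvd : g + 1 ∣ 4 * h + 2) (hbsq : ¬ IsSquare b)
    (hasq : IsSquare a) (h2sq : IsSquare (2 : L)) (hcd : IsSquare (c * d)) (hb : ‖b‖ < 1)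
    (ha : ‖a - 1‖ < 1) (hc : ‖c‖ = 1) (hd : ‖d‖ = 1) (hxz : x ≠ 0 ∨ z ≠ 0) :
    HasFiberPoint h g a b c d x z := by
  have hn : ‖((g + 1 : ℕ) : L)‖ = 1 := norm_natCast_eq_one hp hpn g.succ_pos (by nlinarith)
  have ha1 : ‖a‖ = 1 := by rw [norm_eq_of_norm_sub_lt (y := 1) (by simpa using ha), norm_one]
  by_cases hz0 : z = 0
  · have hx0 := hxz.resolve_right (not_not.mpr hz0)
    have hP0 : 0 < ‖x ^ (g + 1)‖ := norm_pos_iff.mpr (pow_ne_zero _ hx0)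
    refine hasFiberPoint_of_norm_b_mul_lt hn hdvd ha hc hd ?_
    have hb1 : ‖b‖ * (‖b‖ ^ (2 * h + 1)) ^ 2 < 1 :=
      mul_lt_one_of_nonneg_of_lt_one_left (norm_nonneg _) hb
        (pow_le_one₀ (by positivity) (pow_le_one₀ (norm_nonneg _) hb.le))
    calc _ = ‖b‖ * (‖b‖ ^ (2 * h + 1)) ^ 2 * ‖x ^ (g + 1)‖ ^ 2 := by
          simp only [homD, hz0, zero_pow g.succ_ne_zero, sub_zero, norm_mul, norm_pow, ha1]
          ring
      _ < 1 * ‖x ^ (g + 1)‖ ^ 2 := by gcongr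
      _ = _ := by simp [ha1]
  · suffices HasFiberPoint h g a b c d (x / z) 1 by
      have := this.mul_mul z
      rwa [mul_one, mul_div_cancel₀ _ hz0] at this
    rcases lt_or_ge ‖b * homD a b h g (x / z) 1 ^ 2‖
      ‖(a ^ (2 * h + 1) * (x / z) ^ (g + 1)) ^ 2‖ with hlt | hle
    · exact hasFiberPoint_of_norm_b_mul_lt hn hdvd ha hc hd hlt
    · exact hasFiberPoint_of_le_norm_b_mul hp hpn hg hgo hpg hbsq hasq h2sq hcd hb ha1 hc hd hle

end Local

end Fibers
section AdicCompletion

open scoped Valued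

variable {K : Type*} [Field K] [NumberField K] (π : HeightOneSpectrum (𝓞 K))

lemma norm_intToAdicCompletion_le_one (x : 𝓞 K) : ‖intToAdicCompletion π x‖ ≤ 1 :=
  FinitePlace.norm_le_one K π x

lemma norm_intToAdicCompletion_eq_one_iff (x : 𝓞 K) :
    ‖intToAdicCompletion π x‖ = 1 ↔ x ∉ π.asIdeal :=
  FinitePlace.norm_eq_one_iff_notMem K π x

lemma norm_intToAdicCompletion_lt_one_iff (x : 𝓞 K) :
    ‖intToAdicCompletion π x‖ < 1 ↔ x ∈ π.asIdeal :=
  FinitePlace.norm_lt_one_iff_mem K π x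

/-- The ring homomorphism `𝓞 K → K_π`. -/
noncomputable def intToAdicCompletionHom : 𝓞 K →+* π.adicCompletion K :=
  (algebraMap K (π.adicCompletion K)).comp (algebraMap (𝓞 K) K)

lemma exists_norm_sub_intToAdicCompletion_lt_one {y : π.adicCompletion K} (hy : ‖y‖ ≤ 1) :
    ∃ r : 𝓞 K, ‖y - intToAdicCompletion π r‖ < 1 := by
  obtain ⟨x, hx⟩ := (HeightOneSpectrum.denseRange_algebraMap (K := K) (v := π)).exists_dist_lt y
    one_pos
  rw [dist_eq_norm] at hx
  have hx1 : ‖algebraMap K (π.adicCompletion K) x‖ ≤ 1 := by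
    have := IsUltrametricDist.norm_add_le_max y (algebraMap K (π.adicCompletion K) x - y)
    rw [add_sub_cancel, norm_sub_rev] at this
    exact this.trans (max_le hy hx.le)
  have hv : π.valuation K x ≤ 1 := by
    rw [← HeightOneSpectrum.valuedAdicCompletion_eq_valuation']
    exact Valued.toNormedField.norm_le_one_iff.mp hx1
  obtain ⟨r, hr⟩ := π.exists_valuation_sub_lt_of_integer hv 1
  refine ⟨r, ?_⟩
  have hr1 : ‖algebraMap K (π.adicCompletion K) x - intToAdicCompletion π r‖ < 1 := by
    rw [norm_sub_rev, intToAdicCompletion, ← map_sub]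
    refine Valued.toNormedField.norm_lt_one_iff.mpr ?_
    have := HeightOneSpectrum.valuedAdicCompletion_eq_valuation' π (algebraMap (𝓞 K) K r - x)
    exact (this.trans_lt hr)
  have := IsUltrametricDist.norm_add_le_max (y - algebraMap K (π.adicCompletion K) x)
    (algebraMap K (π.adicCompletion K) x - intToAdicCompletion π r)
  rw [sub_add_sub_cancel] at this
  exact this.trans_lt (max_lt hx hr1)

lemma finite_residueField_adicCompletion : Finite 𝓀[π.adicCompletion K] := by
  have := π.asIdeal.finiteQuotientOfFreeOfNeBot π.ne_bot
  let f : 𝓞 K →+* 𝒪[π.adicCompletion K] :=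
    (intToAdicCompletionHom π).codRestrict _ fun x =>
      Valued.toNormedField.norm_le_one_iff.mp (norm_intToAdicCompletion_le_one π x)
  have key (y : 𝒪[π.adicCompletion K]) :
      IsLocalRing.residue _ y = 0 ↔ ‖(y : π.adicCompletion K)‖ < 1 := by
    rw [IsLocalRing.residue_eq_zero_iff, IsLocalRing.mem_maximalIdeal, mem_nonunits_iff,
      (Valuation.integer.integers (Valued.v (R := π.adicCompletion K))).isUnit_iff_valuation_eq_one]
    rw [Valued.toNormedField.norm_lt_one_iff]
    exact ⟨fun h => lt_of_le_of_ne y.2 h, fun h => h.ne⟩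
  let F : 𝓞 K ⧸ π.asIdeal →+* 𝓀[π.adicCompletion K] :=
    Ideal.Quotient.lift π.asIdeal ((IsLocalRing.residue _).comp f) fun x hx =>
      (key (f x)).mpr ((norm_intToAdicCompletion_lt_one_iff π x).mpr hx)
  refine Finite.of_surjective F fun z => ?_
  obtain ⟨y, rfl⟩ := IsLocalRing.residue_surjective z
  obtain ⟨r, hr⟩ := exists_norm_sub_intToAdicCompletion_lt_one π
    (Valued.toNormedField.norm_le_one_iff.mpr y.2)
  refine ⟨Ideal.Quotient.mk _ r, ?_⟩
  have : IsLocalRing.residue _ (y - f r) = 0 := (key _).mpr hr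
  rw [map_sub, sub_eq_zero] at this
  exact this.symm

instance properSpace_adicCompletion : ProperSpace (π.adicCompletion K) := by
  open Valued.integer in
  rw [properSpace_iff_completeSpace_and_isDiscreteValuationRing_integer_and_finite_residueField]
  refine ⟨inferInstance, ?_, finite_residueField_adicCompletion π⟩
  exact inferInstanceAs (IsDiscreteValuationRing (π.adicCompletionIntegers K))

end AdicCompletion

section FinitePlaces

open scoped Valued

variable {K : Type u} [Field K] [NumberField K]

lemma HeightOneSpectrum.eq_of_mem_of_asIdeal_eq_span {π v : HeightOneSpectrum (𝓞 K)} {x : 𝓞 K}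
    (hv : v.asIdeal = Ideal.span {x}) (hx : x ∈ π.asIdeal) : π = v := by
  have hle : v.asIdeal ≤ π.asIdeal := by
    rwa [hv, Ideal.span_singleton_le_iff_mem]
  exact HeightOneSpectrum.ext (v.isMaximal.eq_of_le π.isPrime.ne_top hle).symm

lemma norm_natCast_ringChar_lt_one (π : HeightOneSpectrum (𝓞 K)) :
    ‖((ringChar (𝓞 K ⧸ π.asIdeal) : ℕ) : π.adicCompletion K)‖ < 1 := by
  have : ((ringChar (𝓞 K ⧸ π.asIdeal) : ℕ) : 𝓞 K) ∈ π.asIdeal := by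
    rw [← Ideal.Quotient.eq_zero_iff_mem, map_natCast]
    exact ringChar.Nat.cast_ringChar
  simpa [intToAdicCompletion] using (norm_intToAdicCompletion_lt_one_iff π _).mpr this

lemma prime_ringChar_quotient (π : HeightOneSpectrum (𝓞 K)) :
    (ringChar (𝓞 K ⧸ π.asIdeal)).Prime := by
  have := π.asIdeal.finiteQuotientOfFreeOfNeBot π.ne_bot
  have := π.isPrime
  exact CharP.char_is_prime (𝓞 K ⧸ π.asIdeal) _

theorem xAllFibers_intToLocalExt {h g : ℕ} (hg : 1 ≤ g) (hgo : Odd g)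
    (hdvd : g + 1 ∣ 4 * h + 2) {a b c d : 𝓞 K} {va vb vc vd : HeightOneSpectrum (𝓞 K)}
    (hP : Params K g a b c d va vb vc vd) (π : HeightOneSpectrum (𝓞 K))
    (L : Type u) [NontriviallyNormedField L] [IsUltrametricDist L] [ProperSpace L]
    [Algebra (π.adicCompletion K) L]
    (hL : ∀ x : π.adicCompletion K, ‖algebraMap (π.adicCompletion K) L x‖ = ‖x‖) :
    XAllFibers h g (intToLocalExt π L a) (intToLocalExt π L b)
      (intToLocalExt π L c) (intToLocalExt π L d) := by
  obtain ⟨hva, hvb, hvc, hvd⟩ := And.intro hP.span_a (And.intro hP.span_b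
    (And.intro hP.span_c hP.span_d))
  have ha0 : intToLocalExt π L a ≠ 0 := by
    have : a ≠ 0 := by
      rintro rfl
      exact va.ne_bot (by simpa using hva)
    simpa [intToLocalExt, intToAdicCompletion] using this
  by_cases hab : IsSquare (intToLocalExt π L a * intToLocalExt π L b)
  · exact xAllFibers_of_isSquare_mul ha0 hab
  let f : 𝓞 K →+* L := ((algebraMap (π.adicCompletion K) L).comp
    (algebraMap K (π.adicCompletion K))).comp (algebraMap (𝓞 K) K)
  have hf (x : 𝓞 K) : intToLocalExt π L x = f x := rfl
  have hsq {x : 𝓞 K} (hx : IsSquare (intToAdicCompletion π x)) :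
      IsSquare (intToLocalExt π L x) := hx.map (algebraMap (π.adicCompletion K) L)
  have hbig : 4 * g ^ 2 < ringChar (𝓞 K ⧸ π.asIdeal) := by
    by_contra hlt
    obtain ⟨h1, h2⟩ := hP.sq_ab_bad π (Or.inr (not_lt.mp hlt))
    exact hab ((hsq h1).mul (hsq h2))
  have hp := prime_ringChar_quotient π
  have hpπ := norm_natCast_ringChar_lt_one π
  set p := ringChar (𝓞 K ⧸ π.asIdeal)
  have hpL : ‖(p : L)‖ < 1 := by rw [← hL, map_natCast] at hpπ; exact hpπ
  have hle (x : 𝓞 K) : ‖intToLocalExt π L x‖ ≤ 1 :=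
    (hL _).trans_le (norm_intToAdicCompletion_le_one π x)
  have hone {x : 𝓞 K} {v : HeightOneSpectrum (𝓞 K)} (hv : v.asIdeal = Ideal.span {x})
      (hne : π ≠ v) : ‖intToAdicCompletion π x‖ = 1 :=
    (norm_intToAdicCompletion_eq_one_iff π x).mpr fun hx =>
      hne (HeightOneSpectrum.eq_of_mem_of_asIdeal_eq_span hv hx)
  have honeL {x : 𝓞 K} {v : HeightOneSpectrum (𝓞 K)} (hv : v.asIdeal = Ideal.span {x})
      (hne : π ≠ v) : ‖intToLocalExt π L x‖ = 1 := (hL _).trans (hone hv hne)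
  have hlt {x : 𝓞 K} (hx : x ∈ π.asIdeal) : ‖intToLocalExt π L x‖ < 1 :=
    (hL _).trans_lt ((norm_intToAdicCompletion_lt_one_iff π x).mpr hx)
  have hp2 : 2 < p := by nlinarith
  obtain ⟨hnab, hnac, hnad, hnbc, hnbd, hncd⟩ := hP.distinct
  by_cases hπa : π = va
  · subst hπa
    have hb := hsq hP.b_sq_a
    refine xAllFibers_of_hasFiberPoint fun x z hxz => hasFiberPoint_of_norm_a_lt_one hp hpL hg hgo
      hbig hdvd (fun ha => hab (ha.mul hb)) hb
      (hlt (hva ▸ Ideal.mem_span_singleton_self a)) (honeL hvb hnab) (honeL hvc hnac) (hle d) ?_ hxz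
    have hbcd := hlt (hva ▸ Ideal.mem_span_singleton.mpr hP.cong_bcd)
    rwa [hf, map_sub, map_mul, map_mul, map_pow, map_one] at hbcd
  by_cases hπb : π = vb
  · subst hπb
    have ha := hsq hP.a_sq_b
    refine xAllFibers_of_hasFiberPoint fun x z hxz => hasFiberPoint_of_norm_b_lt_one hp hpL hg hgo
      hbig hdvd (fun hb => hab (ha.mul hb)) ha ?_ ?_
      (hlt (hvb ▸ Ideal.mem_span_singleton_self b)) ?_ (honeL hvc hnbc) (honeL hvd hnbd) hxz
    · have h2 := hP.sq_two_b.map (algebraMap (π.adicCompletion K) L)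
      rwa [map_ofNat] at h2
    · have := isSquare_mul_of_not_isSquare_of_norm hp hp2 hpπ (hone hvc hnbc) (hone hvd hnbd)
        hP.c_nsq_b hP.d_nsq_b
      simpa [intToLocalExt] using this.map (algebraMap (π.adicCompletion K) L)
    · have ha1 := hlt (hvb ▸ Ideal.mem_span_singleton.mpr hP.cong_a)
      rwa [hf, map_sub, map_one] at ha1
  by_cases hπc : π = vc
  · subst hπc
    have := isSquare_mul_of_not_isSquare_of_norm hp hp2 hpπ (hone hva hπa) (hone hvb hπb)
      hP.a_nsq_c hP.b_nsq_c
    exact absurd (by simpa [intToLocalExt] using this.map (algebraMap (π.adicCompletion K) L)) hab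
  exact xAllFibers_of_hasFiberPoint fun x z hxz => hasFiberPoint_of_norm_eq_one hp hpL hg hgo hbig
    hab (honeL hva hπa) (honeL hvb hπb) (honeL hvc hπc) (hle d) hxz

theorem xAllFibers_intToLocalExt_of_finiteDimensional {h g : ℕ} (hg : 1 ≤ g) (hgo : Odd g)
    (hdvd : g + 1 ∣ 4 * h + 2) {a b c d : 𝓞 K} {va vb vc vd : HeightOneSpectrum (𝓞 K)}
    (hP : Params K g a b c d va vb vc vd) (π : HeightOneSpectrum (𝓞 K))
    (L : Type u) [Field L] [Algebra (π.adicCompletion K) L]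
    [FiniteDimensional (π.adicCompletion K) L] :
    XAllFibers h g (intToLocalExt π L a) (intToLocalExt π L b)
      (intToLocalExt π L c) (intToLocalExt π L d) := by
  let : NontriviallyNormedField L := spectralNorm.nontriviallyNormedField (π.adicCompletion K) L
  let : NormedAlgebra (π.adicCompletion K) L := spectralNorm.normedAlgebra (π.adicCompletion K) L
  have : IsUltrametricDist L :=
    IsUltrametricDist.isUltrametricDist_of_isNonarchimedean_norm isNonarchimedean_spectralNorm
  have : ProperSpace L := FiniteDimensional.proper (π.adicCompletion K) L
  exact xAllFibers_intToLocalExt hg hgo hdvd hP π L spectralNorm_extends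

end FinitePlaces

/-- Theorem 5.1(1) for the family of hyperelliptic curves: if `g` is odd and
`g+1 ∣ 4h+2`, then for every place `v` of `K` (finite or archimedean: real and complex
embeddings give all archimedean completions, and every finite extension of an
archimedean completion is `ℝ` or `ℂ`), every finite field extension `L` of the
completion `K_v`, and every `θ ∈ L ∪ {∞}`, the curve `X_θ` has an `L`-point;
i.e. `X(L) → ℙ¹(L)` is surjective for every local field `L` containing `K`. -/
theorem stmt14 (K : Type u) [Field K] [NumberField K] (h g : ℕ) (hg1 : 1 ≤ g)
    (hgodd : Odd g) (hdvd : (g + 1) ∣ (4 * h + 2)) (a b c d : 𝓞 K)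
    (va vb vc vd : HeightOneSpectrum (𝓞 K)) (hP : Params K g a b c d va vb vc vd) :
    (∀ (π : HeightOneSpectrum (𝓞 K)) (L : Type u) [Field L]
        [Algebra (π.adicCompletion K) L] [FiniteDimensional (π.adicCompletion K) L],
      XAllFibers h g (intToLocalExt π L a) (intToLocalExt π L b)
        (intToLocalExt π L c) (intToLocalExt π L d)) ∧
    (∀ σ : K →+* ℝ,
      XAllFibers h g (σ (algebraMap (𝓞 K) K a)) (σ (algebraMap (𝓞 K) K b))
        (σ (algebraMap (𝓞 K) K c)) (σ (algebraMap (𝓞 K) K d))) ∧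
    (∀ σ : K →+* ℂ,
      XAllFibers h g (σ (algebraMap (𝓞 K) K a)) (σ (algebraMap (𝓞 K) K b))
        (σ (algebraMap (𝓞 K) K c)) (σ (algebraMap (𝓞 K) K d))) := by
  refine ⟨fun π L _ _ _ => xAllFibers_intToLocalExt_of_finiteDimensional hg1 hgodd hdvd hP π L,
    fun σ => ?_, fun σ => ?_⟩
  · obtain ⟨ha, hb⟩ := hP.pos_real σ
    exact xAllFibers_of_isSquare_mul ha.ne'
      ⟨_, (Real.mul_self_sqrt (mul_pos ha hb).le).symm⟩
  · have ha : a ≠ 0 := by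
      rintro rfl
      exact va.ne_bot (by simpa using hP.span_a)
    exact xAllFibers_of_isSquare_mul (by simpa using ha) (IsAlgClosed.exists_eq_mul_self _)
end
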